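/- Let y₁, …, y_n > 0 and a₁, …, a_n ∈ ℝ, and set Ĵ = Σ_k a_k J^{y_k} with Hamiltonian vector field X_Ĵ = Σ_k a_k X_{J^{y_k}}. For every positive integer d and every u₀ ∈ 𝒱(d), the evolution equation u̇ = X_Ĵ(u) has a unique global solution u ∈ C^∞(ℝ, 𝒱(d)) with u(0) = u₀; i.e. this equation defines a smooth flow on 𝒱(d). -/

import Mathlib

open scoped BigOperators ComplexConjugate

noncomputable section

/-- The Hardy space `L²₊(𝕋)` of the circle, modeled by the Hilbert space `ℓ²(ℕ, ℂ)` of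
sequences of nonnegative Fourier (= Taylor) coefficients. -/
abbrev Hardy : Type := lp (fun _ : ℕ => ℂ) 2

/-- The Fourier coefficients of an element of the Hardy space. -/
def coeffs (f : Hardy) : ℕ → ℂ := fun n => f n

/-- Membership in the Sobolev space `Hˢ₊(𝕋)`, expressed on Fourier coefficients. -/
def InHs (s : ℝ) (u : ℕ → ℂ) : Prop :=
  Summable fun k : ℕ => ((1 : ℝ) + (k : ℝ) ^ 2) ^ s * ‖u k‖ ^ 2

/-- The `Hˢ` norm, expressed on Fourier coefficients. -/
def hsNorm (s : ℝ) (u : ℕ → ℂ) : ℝ :=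
  Real.sqrt (∑' k : ℕ, ((1 : ℝ) + (k : ℝ) ^ 2) ^ s * ‖u k‖ ^ 2)

/-- Membership in the Wiener algebra `W`. -/
def InW (u : ℕ → ℂ) : Prop := Summable fun k : ℕ => ‖u k‖

/-- The Wiener norm `‖u‖_W = Σ |û(k)|`. -/
def wienerNorm (u : ℕ → ℂ) : ℝ := ∑' k : ℕ, ‖u k‖

/-- The `L²` norm, expressed on Fourier coefficients. -/
def l2Norm (u : ℕ → ℂ) : ℝ := Real.sqrt (∑' k : ℕ, ‖u k‖ ^ 2)

/-- The Hankel operator `H_u(h) = Π(u h̄)`, expressed on Fourier coefficients: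
`(H_u h)^(n) = Σ_p û(n+p) conj(ĥ(p))`. -/
def hankel (u h : ℕ → ℂ) : ℕ → ℂ := fun n => ∑' p : ℕ, u (n + p) * conj (h p)

/-- The shifted Hankel operator `K_u = S* H_u`. -/
def shiftedHankel (u h : ℕ → ℂ) : ℕ → ℂ := fun n => hankel u h (n + 1)

/-- Fourier coefficients of the pointwise product `fg` of two holomorphic (Hardy class)
functions: the Cauchy product. -/
def mulCoeff (f g : ℕ → ℂ) : ℕ → ℂ := fun n => ∑ p ∈ Finset.range (n + 1), f p * g (n - p)

/-- Fourier coefficients of `T_{a b̄}(h) = Π(a b̄ h)` for `a, b, h` in the Hardy class. -/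
def toeplitzAB (a b h : ℕ → ℂ) : ℕ → ℂ :=
  fun n => ∑' q : ℕ, conj (b q) * mulCoeff a h (n + q)

/-- Fourier coefficients of `T_{ā}(h) = Π(ā h)` for `a, h` in the Hardy class. -/
def toeplitzConj (a h : ℕ → ℂ) : ℕ → ℂ := fun n => ∑' q : ℕ, conj (a q) * h (n + q)

/-- The Szegő nonlinearity `Π(|u|²u) = T_{u ū}(u)`. -/
def szegoNL (u : ℕ → ℂ) : ℕ → ℂ := toeplitzAB u u u

/-- The operator `B_u = (i/2) H_u² - i T_{|u|²}` of the Lax pair. -/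
def laxB (u h : ℕ → ℂ) : ℕ → ℂ := fun n =>
  Complex.I / 2 * hankel u (hankel u h) n - Complex.I * toeplitzAB u u h n

/-- The operator `C_u = (i/2) K_u² - i T_{|u|²}` of the Lax pair. -/
def laxC (u h : ℕ → ℂ) : ℕ → ℂ := fun n =>
  Complex.I / 2 * shiftedHankel u (shiftedHankel u h) n - Complex.I * toeplitzAB u u h n

/-- `u : ℝ → L²₊` is a (smooth in time, `Hˢ`-valued) solution of the cubic Szegő equation
`i ∂_t u = Π(|u|²u)`. -/
def IsSzegoSolution (s : ℝ) (u : ℝ → Hardy) : Prop :=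
  (∀ t, InHs s (coeffs (u t))) ∧ ContDiff ℝ (⊤ : ℕ∞) u ∧
    ∀ t n, HasDerivAt (fun τ : ℝ => coeffs (u τ) n) (-Complex.I * szegoNL (coeffs (u t)) n) t

/-- The Hankel operator with symbol `u` (composed with complex conjugation, which does not
change its range), as a linear map on finitely supported sequences. -/
def hankelLM (u : ℕ → ℂ) : (ℕ →₀ ℂ) →ₗ[ℂ] (ℕ → ℂ) :=
  Finsupp.lsum ℂ fun p => LinearMap.toSpanSingleton ℂ (ℕ → ℂ) fun n => u (n + p)

/-- The rank of the Hankel operator `H_u`. -/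
def hankelRank (u : ℕ → ℂ) : ℕ := Module.finrank ℂ (LinearMap.range (hankelLM u))

/-- The finite rank manifold `𝒱(d)`: `u` with `rk H_u = [(d+1)/2]` and `rk K_u = [d/2]`
(recall `K_u = H_{S*u}`). -/
def InV (d : ℕ) (u : ℕ → ℂ) : Prop :=
  InHs (1 / 2) u ∧ FiniteDimensional ℂ (LinearMap.range (hankelLM u)) ∧
    hankelRank u = (d + 1) / 2 ∧ hankelRank (fun n => u (n + 1)) = d / 2

/-- `w = w^y = (I + y H_u²)⁻¹(1)`, characterized by `(I + y H_u²) w = 1`. -/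
def IsResolventOne (y : ℝ) (u w : ℕ → ℂ) : Prop :=
  Memℓp w 2 ∧ ∀ n, w n + (y : ℂ) * hankel u (hankel u w) n = if n = 0 then 1 else 0

/-- The Hamiltonian vector field `X_{J^y}(u) = 2iy w^y H_u(w^y)` (a pointwise product of two
Hardy class functions), expressed on Fourier coefficients; `w` stands for `w^y`. -/
def XJ (y : ℝ) (u w : ℕ → ℂ) : ℕ → ℂ :=
  fun n => 2 * Complex.I * (y : ℂ) * mulCoeff w (hankel u w) n

/-- The operator `G_u^y(h) = -y w^y Π(conj(w^y) h) + y² (H_u w^y) Π(conj(H_u w^y) h)`;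
`w` stands for `w^y`. -/
def Gop (y : ℝ) (u w h : ℕ → ℂ) : ℕ → ℂ := fun n =>
  -(y : ℂ) * mulCoeff w (toeplitzConj w h) n
    + (y : ℂ) ^ 2 * mulCoeff (hankel u w) (toeplitzConj (hankel u w) h) n

/-- The operator `F_u^y(h) = G_u^y(h) - y² (h | H_u w^y) H_u w^y`; `w` stands for `w^y`. -/
def Fop (y : ℝ) (u w h : ℕ → ℂ) : ℕ → ℂ := fun n =>
  Gop y u w h n - (y : ℂ) ^ 2 * (∑' p : ℕ, h p * conj (hankel u w p)) * hankel u w n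


/-- `u : ℝ → L²₊` solves the hierarchy equation `u̇ = X_Ĵ(u)`, `Ĵ = Σ_k a_k J^{y_k}`: at each
time `t`, for the resolvents `W k = w^{y_k} = (I + y_k H_{u(t)}²)⁻¹(1)` (which exist and are
unique), the derivative of each Fourier coefficient is `Σ_k a_k X_{J^{y_k}}(u(t))`. -/
def IsHierSolution (m : ℕ) (y a : Fin m → ℝ) (u : ℝ → Hardy) : Prop :=
  ∀ (t : ℝ) (n : ℕ) (W : Fin m → ℕ → ℂ),
    (∀ k, IsResolventOne (y k) (coeffs (u t)) (W k)) →
    HasDerivAt (fun τ : ℝ => coeffs (u τ) n)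
      (∑ k, (a k : ℂ) * XJ (y k) (coeffs (u t)) (W k) n) t

section ODE

open Set Metric Filter
open scoped NNReal Topology

variable {E : Type*} [NormedAddCommGroup E] [NormedSpace ℝ E]

/-- Two-sided Grönwall bound, with a constant depending only on the data. -/
theorem exists_gronwall_bound (δ K ε T : ℝ) : ∃ R : ℝ, 0 ≤ R ∧
    ∀ (F : Type) [NormedAddCommGroup F] [NormedSpace ℝ F] (f f' : ℝ → F),
      (∀ t ∈ Icc (-T) T, HasDerivWithinAt f (f' t) (Icc (-T) T) t) → ‖f 0‖ ≤ δ →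
      (∀ t ∈ Icc (-T) T, ‖f' t‖ ≤ K * ‖f t‖ + ε) → ∀ t ∈ Icc (-T) T, ‖f t‖ ≤ R := by
  obtain ⟨R, hR⟩ := (isCompact_Icc (a := (0 : ℝ)) (b := T)).bddAbove_image
    (f := gronwallBound δ K ε)
    (fun x _ => (hasDerivAt_gronwallBound δ K ε x).continuousAt.continuousWithinAt)
  refine ⟨max R 0, le_max_right _ _, fun F _ _ f f' hf h0 hb t ht => le_trans ?_ (le_max_left _ _)⟩
  have hTT : -T ≤ T := ht.1.trans ht.2
  have hT : 0 ≤ T := by linarith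
  have key : ∀ (g g' : ℝ → F), (∀ t ∈ Icc (-T) T, HasDerivWithinAt g (g' t) (Icc (-T) T) t) →
      ‖g 0‖ ≤ δ → (∀ t ∈ Icc (-T) T, ‖g' t‖ ≤ K * ‖g t‖ + ε) → ∀ t ∈ Icc 0 T, ‖g t‖ ≤ R := by
    intro g g' hg hg0 hgb t ht
    have hsub : Icc 0 T ⊆ Icc (-T) T := Icc_subset_Icc_left (by linarith)
    have h := norm_le_gronwallBound_of_norm_deriv_right_le (f := g) (f' := g') (δ := δ) (K := K)
      (ε := ε) (a := 0) (b := T)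
      (fun x hx => ((hg x (hsub hx)).continuousWithinAt).mono hsub)
      (fun x hx => by
        have hx' : x ∈ Icc (-T) T := hsub ⟨hx.1, hx.2.le⟩
        refine (hg x hx').mono_of_mem_nhdsWithin ?_
        filter_upwards [Icc_mem_nhdsGE hx.2] with z hz
        exact ⟨hx'.1.trans hz.1, hz.2⟩)
      hg0 (fun x hx => hgb x (hsub ⟨hx.1, hx.2.le⟩)) t ht
    rw [sub_zero] at h
    exact h.trans (hR (mem_image_of_mem _ ht))
  rcases le_total 0 t with h | h
  · exact key f f' hf h0 hb t ⟨h, ht.2⟩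
  · have := key (fun s => f (-s)) (fun s => -f' (-s)) (fun s hs => ?_) (by simpa using h0)
      (fun s hs => by simpa using hb (-s) ⟨by linarith [hs.2], by linarith [hs.1]⟩) (-t)
      ⟨by linarith, by linarith [ht.1]⟩
    · simpa using this
    · have hs' : -s ∈ Icc (-T) T := ⟨by linarith [hs.2], by linarith [hs.1]⟩
      have := (hf (-s) hs').scomp s ((hasDerivAt_neg s).hasDerivWithinAt (s := Icc (-T) T))
        (fun z hz => ⟨by linarith [hz.2], by linarith [hz.1]⟩)
      simpa using! this

/-- The radial retraction onto the ball of radius `R` is `2`-Lipschitz. -/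
theorem norm_radial_sub_le {R : ℝ} (hR : 0 < R) (x y : E) :
    ‖(R / max R ‖x‖) • x - (R / max R ‖y‖) • y‖ ≤ 2 * ‖x - y‖ := by
  have hx : 0 < max R ‖x‖ := lt_max_of_lt_left hR
  have hy : 0 < max R ‖y‖ := lt_max_of_lt_left hR
  have e : (R / max R ‖x‖) • x - (R / max R ‖y‖) • y
      = (R / max R ‖x‖) • (x - y) + (R / max R ‖x‖ - R / max R ‖y‖) • y := by module
  have c1 : R / max R ‖x‖ ≤ 1 := (div_le_one hx).2 (le_max_left _ _)
  have c0 : 0 ≤ R / max R ‖x‖ := by positivity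
  have h1 : ‖(R / max R ‖x‖) • (x - y)‖ ≤ ‖x - y‖ := by
    rw [norm_smul, Real.norm_of_nonneg c0]
    exact mul_le_of_le_one_left (norm_nonneg _) c1
  have h2 : ‖(R / max R ‖x‖ - R / max R ‖y‖) • y‖ ≤ ‖x - y‖ := by
    have e2 : R / max R ‖x‖ - R / max R ‖y‖
        = (R / max R ‖x‖) * ((max R ‖y‖ - max R ‖x‖) / max R ‖y‖) := by
      field_simp
    have h3 : |max R ‖y‖ - max R ‖x‖| ≤ ‖x - y‖ := by
      refine (abs_max_sub_max_le_max R ‖y‖ R ‖x‖).trans ?_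
      rw [sub_self, abs_zero, norm_sub_rev x y]
      exact max_le (norm_nonneg _) (abs_norm_sub_norm_le _ _)
    rw [norm_smul, e2, Real.norm_eq_abs, abs_mul, abs_of_nonneg c0, abs_div, abs_of_pos hy, mul_assoc]
    refine (mul_le_of_le_one_left (by positivity) c1).trans ?_
    rw [div_mul_eq_mul_div]
    rw [div_le_iff₀ hy]
    exact mul_le_mul h3 (le_max_right _ _) (norm_nonneg _) (norm_nonneg _)
  rw [e]
  linarith [norm_add_le ((R / max R ‖x‖) • (x - y)) ((R / max R ‖x‖ - R / max R ‖y‖) • y)]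

/-- A time-dependent vector field which is Lipschitz on balls and for which the solutions of the
damped equations satisfy an a priori bound has a solution on `[-T, T]`. -/
theorem exists_solution_Icc_of_apriori [CompleteSpace E] {f : ℝ → E → E} {x₀ : E} {T : ℝ}
    (hT : 0 ≤ T)
    (hlip : ∀ R, ∃ K : ℝ≥0, ∀ t ∈ Icc (-T) T, LipschitzOnWith K (f t) (closedBall 0 R))
    (hcont : ∀ x, ContinuousOn (f · x) (Icc (-T) T))
    (hap : ∃ R, ∀ (u : ℝ → E) (c : ℝ → ℝ), (∀ t, c t ∈ Icc (0 : ℝ) 1) → u 0 = x₀ →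
      (∀ t ∈ Icc (-T) T, HasDerivWithinAt u (f t (c t • u t)) (Icc (-T) T) t) →
      ∀ t ∈ Icc (-T) T, ‖u t‖ ≤ R) :
    ∃ u : ℝ → E, u 0 = x₀ ∧
      ∀ t ∈ Icc (-T) T, HasDerivWithinAt u (f t (u t)) (Icc (-T) T) t := by
  obtain ⟨R₀, hR₀⟩ := hap
  set R := max R₀ 1 with hRdef
  have hR : 0 < R := lt_max_of_lt_right one_pos
  obtain ⟨K, hK⟩ := hlip R
  have h0mem : (0 : ℝ) ∈ Icc (-T) T := ⟨by linarith, hT⟩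
  have hρ : ∀ x : E, (R / max R ‖x‖) • x ∈ closedBall (0 : E) R := fun x => by
    have hx : 0 < max R ‖x‖ := lt_max_of_lt_left hR
    rw [mem_closedBall_zero_iff, norm_smul, Real.norm_of_nonneg (by positivity),
      div_mul_eq_mul_div, div_le_iff₀ hx]
    exact mul_le_mul_of_nonneg_left (le_max_right _ _) hR.le
  obtain ⟨M, hM⟩ := (isCompact_Icc (a := -T) (b := T)).exists_bound_of_continuousOn (hcont 0)
  have hM0 : 0 ≤ M := (norm_nonneg _).trans (hM 0 h0mem)
  have hbd : ∀ t ∈ Icc (-T) T, ∀ x : E, ‖f t ((R / max R ‖x‖) • x)‖ ≤ M + K * R := by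
    intro t ht x
    have h1 := (hK t ht).norm_sub_le (hρ x) (mem_closedBall_self hR.le)
    have h2 := hρ x
    rw [mem_closedBall_zero_iff] at h2
    rw [sub_zero] at h1
    have h3 : (K : ℝ) * ‖(R / max R ‖x‖) • x‖ ≤ K * R := by gcongr
    have h4 := norm_sub_norm_le (f t ((R / max R ‖x‖) • x)) (f t 0)
    linarith [hM t ht]
  obtain ⟨L, hL⟩ : ∃ L : ℝ≥0, (L : ℝ) = M + K * R := ⟨⟨M + K * R, by positivity⟩, rfl⟩
  obtain ⟨T', hT'⟩ : ∃ T' : ℝ≥0, (T' : ℝ) = T := ⟨⟨T, hT⟩, rfl⟩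
  have hpl : IsPicardLindelof (fun t x => f t ((R / max R ‖x‖) • x)) (tmin := -T) (tmax := T)
      ⟨0, h0mem⟩ x₀ (L * T') 0 L (K * 2) :=
    { lipschitzOnWith := fun t ht => by
        refine LipschitzOnWith.of_dist_le_mul fun x _ y _ => ?_
        rw [dist_eq_norm, dist_eq_norm]
        refine ((hK t ht).norm_sub_le (hρ x) (hρ y)).trans ?_
        push_cast
        rw [mul_assoc]
        exact mul_le_mul_of_nonneg_left (norm_radial_sub_le hR x y) K.2
      continuousOn := fun x _ => hcont _
      norm_le := fun t ht x _ => (hbd t ht x).trans_eq hL.symm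
      mul_max_le := by simp [hT'] }
  obtain ⟨u, hu0, hu⟩ := hpl.exists_eq_forall_mem_Icc_hasDerivWithinAt₀
  have hc : ∀ t, R / max R ‖u t‖ ∈ Icc (0 : ℝ) 1 := fun t => by
    have hx : 0 < max R ‖u t‖ := lt_max_of_lt_left hR
    exact ⟨by positivity, (div_le_one hx).2 (le_max_left _ _)⟩
  have hb := hR₀ u _ hc hu0 hu
  refine ⟨u, hu0, fun t ht => ?_⟩
  have h1 := hu t ht
  have h2 : max R ‖u t‖ = R := max_eq_left ((hb t ht).trans (le_max_left _ _))
  simpa only [h2, div_self hR.ne', one_smul] using h1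

/-- Linear equations `V' = B(t) V` are solvable on `[-T, T]`. -/
theorem exists_linear_solution_Icc {E : Type} [NormedAddCommGroup E] [NormedSpace ℝ E]
    [CompleteSpace E] {B : ℝ → E →L[ℝ] E} {T : ℝ} (hT : 0 ≤ T)
    (hB : ContinuousOn B (Icc (-T) T)) (x₀ : E) :
    ∃ u : ℝ → E, u 0 = x₀ ∧ ∀ t ∈ Icc (-T) T, HasDerivWithinAt u (B t (u t)) (Icc (-T) T) t := by
  obtain ⟨M, hM⟩ := (isCompact_Icc (a := -T) (b := T)).exists_bound_of_continuousOn hB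
  have hM0 : 0 ≤ M := (norm_nonneg _).trans (hM 0 ⟨by linarith, hT⟩)
  refine exists_solution_Icc_of_apriori (f := fun t x => B t x) hT (fun R => ⟨⟨M, hM0⟩, fun t ht => ?_⟩)
    (fun x => hB.clm_apply continuousOn_const) ?_
  · refine LipschitzOnWith.of_dist_le_mul fun x _ y _ => ?_
    rw [dist_eq_norm, dist_eq_norm, ← map_sub]
    exact (B t).le_of_opNorm_le (hM t ht) _
  · obtain ⟨R, -, hR⟩ := exists_gronwall_bound ‖x₀‖ M 0 T
    refine ⟨R, fun u c hc hu0 hu => hR E u _ hu (by rw [hu0]) fun t ht => ?_⟩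
    rw [add_zero]
    refine ((B t).le_of_opNorm_le (hM t ht) _).trans ?_
    rw [norm_smul, Real.norm_of_nonneg (hc t).1]
    exact mul_le_mul_of_nonneg_left (mul_le_of_le_one_left (norm_nonneg _) (hc t).2) hM0

/-- Integral curves of smooth vector fields are smooth. -/
theorem contDiff_of_hasDerivAt {f : E → E} (hf : ContDiff ℝ (⊤ : ℕ∞) f) {u : ℝ → E}
    (hu : ∀ t, HasDerivAt u (f (u t)) t) : ContDiff ℝ (⊤ : ℕ∞) u := by
  rw [contDiff_infty]
  intro n
  induction n with
  | zero => exact contDiff_zero.2 (continuous_iff_continuousAt.2 fun t => (hu t).continuousAt)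
  | succ n ih =>
    rw [Nat.cast_add_one, contDiff_succ_iff_deriv]
    refine ⟨fun t => (hu t).differentiableAt, by simp, ?_⟩
    rw [show deriv u = f ∘ u from funext fun t => (hu t).deriv]
    exact (contDiff_infty.1 hf n).comp ih

end ODE

section SequenceSpaces

/-- The Wiener algebra `ℓ¹(ℕ, ℂ)`. -/
abbrev Wiener : Type := lp (fun _ : ℕ => ℂ) 1

/-- The monomial `e^{ikx}` in the Wiener algebra. -/
def wδ (k : ℕ) : Wiener := lp.single 1 k 1

/-- The monomial `e^{ikx}` in the Hardy space. -/
def hδ (k : ℕ) : Hardy := lp.single 2 k 1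

theorem wδ_apply (k n : ℕ) : wδ k n = if n = k then 1 else 0 := by
  rw [wδ, lp.single_apply, Pi.single_apply]

theorem hδ_apply (k n : ℕ) : hδ k n = if n = k then 1 else 0 := by
  rw [hδ, lp.single_apply, Pi.single_apply]

theorem norm_wδ (k : ℕ) : ‖wδ k‖ = 1 := by
  rw [wδ, lp.norm_single one_pos, norm_one]

theorem norm_hδ (k : ℕ) : ‖hδ k‖ = 1 := by
  rw [hδ, lp.norm_single two_pos, norm_one]

@[simp] theorem star_wδ (k : ℕ) : star (wδ k) = wδ k := by
  ext n
  rw [lp.star_apply, wδ_apply]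
  split_ifs <;> simp

@[simp] theorem star_hδ (k : ℕ) : star (hδ k) = hδ k := by
  ext n
  rw [lp.star_apply, hδ_apply]
  split_ifs <;> simp

theorem wiener_hasSum_norm (x : Wiener) : HasSum (fun k => ‖x k‖) ‖x‖ := by
  simpa using lp.hasSum_norm (by simp) x

theorem hardy_hasSum_sq (x : Hardy) : HasSum (fun k => ‖x k‖ ^ 2) (‖x‖ ^ 2) := by
  have := lp.hasSum_norm (by simp) x
  simpa using this

theorem hasSum_smul_wδ (x : Wiener) : HasSum (fun k => x k • wδ k) x := by
  convert lp.hasSum_single ENNReal.one_ne_top x using 2 with k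
  rw [wδ, ← lp.single_smul, smul_eq_mul, mul_one]

theorem hasSum_smul_hδ (x : Hardy) : HasSum (fun k => x k • hδ k) x := by
  convert lp.hasSum_single ENNReal.ofNat_ne_top x using 2 with k
  rw [hδ, ← lp.single_smul, smul_eq_mul, mul_one]

section Ext

variable {X : Type*} [NormedAddCommGroup X] [NormedSpace ℂ X]

theorem wiener_ext {A B : Wiener →L[ℂ] X} (h : ∀ k, A (wδ k) = B (wδ k)) : A = B := by
  ext x
  refine (A.hasSum (hasSum_smul_wδ x)).unique ?_
  convert B.hasSum (hasSum_smul_wδ x) using 2 with k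
  rw [map_smul, map_smul, h]

theorem hardy_ext {A B : Hardy →L[ℂ] X} (h : ∀ k, A (hδ k) = B (hδ k)) : A = B := by
  ext x
  refine (A.hasSum (hasSum_smul_hδ x)).unique ?_
  convert B.hasSum (hasSum_smul_hδ x) using 2 with k
  rw [map_smul, map_smul, h]

variable [CompleteSpace X]

theorem summable_smul_of_bounded {b : ℕ → X} {C : ℝ} (hb : ∀ k, ‖b k‖ ≤ C) (x : Wiener) :
    Summable fun k => x k • b k := by
  refine Summable.of_norm_bounded ((wiener_hasSum_norm x).summable.mul_right C) fun k => ?_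
  rw [norm_smul]
  exact mul_le_mul_of_nonneg_left (hb k) (norm_nonneg _)

/-- The bounded operator on `ℓ¹` with given bounded values on the basis. -/
def lsum (b : ℕ → X) (C : ℝ) (hb : ∀ k, ‖b k‖ ≤ C) : Wiener →L[ℂ] X :=
  LinearMap.mkContinuous
    { toFun := fun x => ∑' k, x k • b k
      map_add' := fun x y => by
        rw [← (summable_smul_of_bounded hb x).tsum_add (summable_smul_of_bounded hb y)]
        simp only [lp.coeFn_add, Pi.add_apply, add_smul]
      map_smul' := fun c x => by
        rw [RingHom.id_apply, ← (summable_smul_of_bounded hb x).tsum_const_smul c]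
        simp only [lp.coeFn_smul, Pi.smul_apply, smul_assoc] } C fun x => by
    have h := (wiener_hasSum_norm x).mul_right C
    rw [mul_comm C]
    refine tsum_of_norm_bounded h fun k => ?_
    rw [norm_smul]
    exact mul_le_mul_of_nonneg_left (hb k) (norm_nonneg _)

theorem lsum_wδ (b : ℕ → X) (C : ℝ) (hb : ∀ k, ‖b k‖ ≤ C) (k : ℕ) : lsum b C hb (wδ k) = b k := by
  change ∑' n, wδ k n • b n = b k
  rw [tsum_eq_single k fun n hn => by rw [wδ_apply, if_neg hn, zero_smul], wδ_apply, if_pos rfl,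
    one_smul]

theorem norm_lsum_le (b : ℕ → X) (C : ℝ) (hb : ∀ k, ‖b k‖ ≤ C) (x : Wiener) :
    ‖lsum b C hb x‖ ≤ C * ‖x‖ := by
  exact (lsum b C hb).le_of_opNorm_le
    (LinearMap.mkContinuous_norm_le _ ((norm_nonneg _).trans (hb 0)) _) x

end Ext

/-- The coordinate functionals on the Hardy space. -/
def hcoord (n : ℕ) : Hardy →L[ℂ] ℂ := lp.evalCLM ℂ (fun _ : ℕ => ℂ) 2 n

/-- The coordinate functionals on the Wiener algebra. -/
def wcoord (n : ℕ) : Wiener →L[ℂ] ℂ := lp.evalCLM ℂ (fun _ : ℕ => ℂ) 1 n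

@[simp] theorem hcoord_apply (n : ℕ) (h : Hardy) : hcoord n h = h n := rfl

@[simp] theorem wcoord_apply (n : ℕ) (h : Wiener) : wcoord n h = h n := rfl

/-- The inclusion `ℓ¹ ⊂ ℓ²`. -/
def incl : Wiener →L[ℂ] Hardy := lsum hδ 1 fun k => (norm_hδ k).le

@[simp] theorem incl_wδ (k : ℕ) : incl (wδ k) = hδ k := lsum_wδ ..

@[simp] theorem incl_apply (x : Wiener) (n : ℕ) : incl x n = x n := by
  have : (hcoord n) ∘L incl = wcoord n := wiener_ext fun k => by
    simp [hδ_apply, wδ_apply]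
  exact DFunLike.congr_fun this x

theorem incl_injective : Function.Injective incl := fun x y h => by
  ext n
  rw [← incl_apply, h, incl_apply]

theorem norm_incl_le (x : Wiener) : ‖incl x‖ ≤ ‖x‖ := by
  exact (norm_lsum_le ..).trans_eq (one_mul _)

theorem incl_star (x : Wiener) : incl (star x) = star (incl x) := by
  ext n
  simp [lp.star_apply]

theorem natCast_add_one_norm (k : ℕ) : ‖(k + 1 : ℂ)‖ = k + 1 := by
  have := Complex.norm_natCast (k + 1)
  push_cast at this
  exact this

theorem natCast_add_one_ne (k : ℕ) : (k + 1 : ℂ) ≠ 0 := Nat.cast_add_one_ne_zero k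

/-- The weighted embedding `x ↦ (x_k / (k+1))_k`. -/
def wι : Wiener →L[ℂ] Wiener := lsum (fun k => (k + 1 : ℂ)⁻¹ • wδ k) 1 fun k => by
  rw [norm_smul, norm_wδ, mul_one, norm_inv, natCast_add_one_norm]
  exact inv_le_one_of_one_le₀ (by norm_cast; omega)

@[simp] theorem wι_wδ (k : ℕ) : wι (wδ k) = (k + 1 : ℂ)⁻¹ • wδ k := lsum_wδ ..

theorem wι_apply (x : Wiener) (n : ℕ) : wι x n = (n + 1 : ℂ)⁻¹ * x n := by
  have : (wcoord n) ∘L wι = (n + 1 : ℂ)⁻¹ • wcoord n := wiener_ext fun k => by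
    simp only [ContinuousLinearMap.comp_apply, wι_wδ, map_smul, wcoord_apply, wδ_apply,
      _root_.smul_apply, smul_eq_mul]
    split_ifs with h
    · rw [h]
    · simp
  exact DFunLike.congr_fun this x

theorem norm_wι_le (x : Wiener) : ‖wι x‖ ≤ ‖x‖ := by
  exact (norm_lsum_le ..).trans_eq (one_mul _)

theorem wι_injective : Function.Injective wι := fun x y h => by
  ext n
  have h1 := congrArg (fun z : Wiener => z n) h
  simp only [wι_apply] at h1
  exact mul_left_cancel₀ (inv_ne_zero (natCast_add_one_ne n)) h1

end SequenceSpaces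

section Operators

/-- The shift on the Hardy space. -/
def hshift : Hardy →ₗᵢ[ℂ] Hardy where
  toFun h := ⟨fun n => if n = 0 then 0 else h (n - 1), memℓp_gen <| by
    refine (summable_nat_add_iff 1).1 ?_
    simpa using (hardy_hasSum_sq h).summable⟩
  map_add' f g := by
    ext n
    change (if n = 0 then 0 else f (n - 1) + g (n - 1))
      = (if n = 0 then 0 else f (n - 1)) + (if n = 0 then 0 else g (n - 1))
    split_ifs <;> simp
  map_smul' c f := by
    ext n
    by_cases hn : n = 0 <;> simp [hn]
  norm_map' h := by
    refine (sq_eq_sq₀ (norm_nonneg _) (norm_nonneg _)).1 ?_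
    refine (hardy_hasSum_sq _).unique ?_
    refine (hasSum_nat_add_iff' 1).1 ?_
    simpa using hardy_hasSum_sq h

/-- The shift on the Hardy space, as a bounded operator. -/
def hS : Hardy →L[ℂ] Hardy := hshift.toContinuousLinearMap

/-- The backward shift. -/
def hSb : Hardy →L[ℂ] Hardy := ContinuousLinearMap.adjoint hS

theorem inner_hδ_left (n : ℕ) (h : Hardy) : inner ℂ (hδ n) h = h n := by
  rw [hδ, lp.inner_single_left]
  simp

theorem inner_hδ_right (n : ℕ) (h : Hardy) : inner ℂ h (hδ n) = conj (h n) := by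
  rw [← inner_conj_symm, inner_hδ_left]

@[simp] theorem hS_hδ (q : ℕ) : hS (hδ q) = hδ (q + 1) := by
  ext n
  change (if n = 0 then 0 else hδ q (n - 1)) = hδ (q + 1) n
  rw [hδ_apply, hδ_apply]
  rcases n with _ | n <;> simp

theorem hSb_apply (h : Hardy) (n : ℕ) : hSb h n = h (n + 1) := by
  rw [← inner_hδ_left, hSb, ContinuousLinearMap.adjoint_inner_right, hS_hδ, inner_hδ_left]

theorem hSb_hδ (q : ℕ) : hSb (hδ q) = if q = 0 then 0 else hδ (q - 1) := by
  ext n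
  rw [hSb_apply]
  rcases q with _ | q
  · simp [hδ_apply]
  · simp [hδ_apply]

theorem hSb_hS (h : Hardy) : hSb (hS h) = h := by
  have : hSb ∘L hS = ContinuousLinearMap.id ℂ Hardy := hardy_ext fun q => by simp [hSb_hδ]
  exact DFunLike.congr_fun this h

theorem norm_hS (h : Hardy) : ‖hS h‖ = ‖h‖ := hshift.norm_map h

theorem norm_hSb_le (h : Hardy) : ‖hSb h‖ ≤ ‖h‖ := by
  have h1 : ‖hSb‖ ≤ 1 := by
    rw [hSb, LinearIsometryEquiv.norm_map]
    exact hshift.norm_toContinuousLinearMap_le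
  simpa using hSb.le_of_opNorm_le h1 h

theorem norm_hS_pow_apply (k : ℕ) (h : Hardy) : ‖(hS ^ k) h‖ = ‖h‖ := by
  induction k with
  | zero => simp
  | succ k ih => rw [pow_succ', mul_apply_eq_comp, norm_hS, ih]

theorem norm_hSb_pow_apply_le (k : ℕ) (h : Hardy) : ‖(hSb ^ k) h‖ ≤ ‖h‖ := by
  induction k with
  | zero => simp
  | succ k ih => rw [pow_succ', mul_apply_eq_comp]; exact (norm_hSb_le _).trans ih

theorem hSb_pow_apply (k : ℕ) (h : Hardy) (n : ℕ) : (hSb ^ k) h n = h (n + k) := by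
  induction k generalizing n with
  | zero => simp
  | succ k ih => rw [pow_succ', mul_apply_eq_comp, hSb_apply, ih, add_right_comm, add_assoc]

/-- Multiplication by an element of the Wiener algebra. -/
def hM : Wiener →L[ℂ] Hardy →L[ℂ] Hardy := lsum (fun k => hS ^ k) 1 fun k =>
  ContinuousLinearMap.opNorm_le_bound _ zero_le_one fun h => by rw [norm_hS_pow_apply, one_mul]

/-- The operators `a ↦ Σ_k a_k (S*)^k`. -/
def hN : Wiener →L[ℂ] Hardy →L[ℂ] Hardy := lsum (fun k => hSb ^ k) 1 fun k =>
  ContinuousLinearMap.opNorm_le_bound _ zero_le_one fun h => by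
    rw [one_mul]; exact norm_hSb_pow_apply_le k h

theorem hM_wδ (k : ℕ) : hM (wδ k) = hS ^ k := lsum_wδ ..

theorem hN_wδ (k : ℕ) : hN (wδ k) = hSb ^ k := lsum_wδ ..

theorem hM_wδ_hδ (k q : ℕ) : hM (wδ k) (hδ q) = hδ (k + q) := by
  rw [hM_wδ]
  induction k with
  | zero => simp
  | succ k ih => rw [pow_succ', mul_apply_eq_comp, ih, hS_hδ, add_right_comm]

theorem hN_wδ_hδ (k q : ℕ) : hN (wδ k) (hδ q) = if k ≤ q then hδ (q - k) else 0 := by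
  rw [hN_wδ]
  ext n
  rw [hSb_pow_apply, hδ_apply]
  split_ifs with h1 h2 h2
  · rw [hδ_apply, if_pos (by omega)]
  · omega
  · rw [hδ_apply, if_neg (by omega)]
  · rfl

/-- The finite flip `h ↦ Σ_{n ≤ k} h_{k-n} e^{inx}`. -/
def wflip (k : ℕ) : Hardy →L[ℂ] Wiener :=
  ∑ n ∈ Finset.range (k + 1), (hcoord (k - n)).smulRight (wδ n)

theorem wflip_apply (k : ℕ) (h : Hardy) :
    wflip k h = ∑ n ∈ Finset.range (k + 1), h (k - n) • wδ n := by
  simp [wflip]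

theorem wflip_hδ (k q : ℕ) : wflip k (hδ q) = if q ≤ k then wδ (k - q) else 0 := by
  rw [wflip_apply]
  split_ifs with h
  · rw [Finset.sum_eq_single (k - q)]
    · rw [hδ_apply, if_pos (by omega), one_smul]
    · intro n hn hne
      rw [Finset.mem_range] at hn
      rw [hδ_apply, if_neg (by omega), zero_smul]
    · intro hn
      rw [Finset.mem_range] at hn
      omega
  · refine Finset.sum_eq_zero fun n hn => ?_
    rw [hδ_apply, if_neg (by omega), zero_smul]

theorem norm_wflip_apply_le (k : ℕ) (h : Hardy) : ‖wflip k h‖ ≤ (k + 1) * ‖h‖ := by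
  rw [wflip_apply]
  refine (norm_sum_le _ _).trans ((Finset.sum_le_card_nsmul _ _ ‖h‖ fun n _ => ?_).trans ?_)
  · rw [norm_smul, norm_wδ, mul_one]
    exact lp.norm_apply_le_norm two_ne_zero h _
  · simp

theorem norm_incl_wflip_le (k : ℕ) (h : Hardy) : ‖incl (wflip k h)‖ ≤ ‖h‖ := by
  refine abs_le_of_sq_le_sq' ?_ (norm_nonneg _) |>.2
  have h1 : incl (wflip k h) = ∑ n ∈ Finset.range (k + 1), lp.single 2 n (h (k - n)) := by
    rw [wflip_apply, map_sum]
    refine Finset.sum_congr rfl fun n _ => ?_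
    rw [map_smul, incl_wδ, hδ, ← lp.single_smul, smul_eq_mul, mul_one]
  have h2 := lp.norm_sum_single (p := 2) (E := fun _ : ℕ => ℂ) (by simp) (fun n => h (k - n))
    (Finset.range (k + 1))
  simp only [ENNReal.toReal_ofNat, Real.rpow_ofNat] at h2
  rw [h1, h2, Finset.sum_range_reflect (fun n => ‖h n‖ ^ 2) (k + 1)
    |>.symm.trans (Finset.sum_congr rfl fun n _ => by congr 4) |>.symm]
  exact sum_le_hasSum _ (fun _ _ => by positivity) (hardy_hasSum_sq h)

/-- The (linear) Hankel operator `(Γ_u h)_n = Σ_p u_{n+p} h_p`. -/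
def hΓ : Wiener →L[ℂ] Hardy →L[ℂ] Hardy := lsum (fun k => incl ∘L wflip k) 1 fun k =>
  ContinuousLinearMap.opNorm_le_bound _ zero_le_one fun h => by
    rw [one_mul]; exact norm_incl_wflip_le k h

theorem hΓ_wδ_hδ (k q : ℕ) : hΓ (wδ k) (hδ q) = if q ≤ k then hδ (k - q) else 0 := by
  rw [hΓ, lsum_wδ, ContinuousLinearMap.comp_apply, wflip_hδ]
  split_ifs <;> simp

/-- The Hankel operator with symbol `wι x`, as an operator from `ℓ²` to `ℓ¹`. -/
def hG : Wiener →L[ℂ] Hardy →L[ℂ] Wiener := lsum (fun k => (k + 1 : ℂ)⁻¹ • wflip k) 1 fun k =>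
  ContinuousLinearMap.opNorm_le_bound _ zero_le_one fun h => by
    rw [_root_.smul_apply, norm_smul, norm_inv, natCast_add_one_norm, one_mul,
      inv_mul_le_iff₀ (by positivity)]
    exact norm_wflip_apply_le k h

theorem incl_hG (x : Wiener) (h : Hardy) : incl (hG x h) = hΓ (wι x) h := by
  have : (ContinuousLinearMap.compL ℂ Hardy Wiener Hardy incl) ∘L hG = hΓ ∘L wι :=
    wiener_ext fun k => by simp [hG, hΓ, lsum_wδ]
  exact DFunLike.congr_fun (DFunLike.congr_fun this x) h

/-- Bounded bilinear operators on `ℓ¹` with given values on the basis. -/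
def lsum₂ (b : ℕ → ℕ → Wiener) (hb : ∀ k p, ‖b k p‖ ≤ 1) :
    Wiener →L[ℂ] Wiener →L[ℂ] Wiener :=
  lsum (fun k => lsum (b k) 1 (hb k)) 1 fun _ =>
    ContinuousLinearMap.opNorm_le_bound _ zero_le_one fun x => norm_lsum_le _ _ _ x

theorem lsum₂_wδ (b : ℕ → ℕ → Wiener) (hb : ∀ k p, ‖b k p‖ ≤ 1) (k p : ℕ) :
    lsum₂ b hb (wδ k) (wδ p) = b k p := by
  rw [lsum₂, lsum_wδ, lsum_wδ]

theorem norm_lsum₂_le (b : ℕ → ℕ → Wiener) (hb : ∀ k p, ‖b k p‖ ≤ 1) (x x' : Wiener) :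
    ‖lsum₂ b hb x x'‖ ≤ ‖x‖ * ‖x'‖ := by
  refine (lsum₂ b hb x).le_of_opNorm_le ?_ x'
  exact (norm_lsum_le ..).trans_eq (one_mul _)

theorem wiener_ext₂ {X : Type*} [NormedAddCommGroup X] [NormedSpace ℂ X]
    {A B : Wiener →L[ℂ] Wiener →L[ℂ] X} (h : ∀ k p, A (wδ k) (wδ p) = B (wδ k) (wδ p)) : A = B :=
  wiener_ext fun k => wiener_ext fun p => h k p

/-- The product (convolution) of the Wiener algebra. -/
def wmul : Wiener →L[ℂ] Wiener →L[ℂ] Wiener := lsum₂ (fun k p => wδ (k + p)) fun _ _ =>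
  (norm_wδ _).le

theorem wmul_wδ (k p : ℕ) : wmul (wδ k) (wδ p) = wδ (k + p) := lsum₂_wδ ..

theorem norm_wmul_le (a b : Wiener) : ‖wmul a b‖ ≤ ‖a‖ * ‖b‖ := norm_lsum₂_le ..

/-- The back-convolution `Π(u ā)` with `a` replaced by its conjugate. -/
def wcor : Wiener →L[ℂ] Wiener →L[ℂ] Wiener :=
  lsum₂ (fun k p => if p ≤ k then wδ (k - p) else 0) fun k p => by
    split_ifs
    · exact (norm_wδ _).le
    · simp

theorem wcor_wδ (k p : ℕ) : wcor (wδ k) (wδ p) = if p ≤ k then wδ (k - p) else 0 := lsum₂_wδ ..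

/-- The back-convolution in the weighted coordinates. -/
def wcorE : Wiener →L[ℂ] Wiener →L[ℂ] Wiener :=
  lsum₂ (fun k p => if p ≤ k then ((((k - p : ℕ) : ℂ) + 1) * (k + 1 : ℂ)⁻¹) • wδ (k - p) else 0)
    fun k p => by
      split_ifs
      · rw [norm_smul, norm_wδ, mul_one, norm_mul, norm_inv, natCast_add_one_norm,
          natCast_add_one_norm, ← div_eq_mul_inv, div_le_one (by positivity)]
        gcongr
        exact Nat.sub_le k p
      · simp

theorem norm_wcorE_le (x a : Wiener) : ‖wcorE x a‖ ≤ ‖x‖ * ‖a‖ := norm_lsum₂_le ..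

theorem wι_wcorE (x a : Wiener) : wι (wcorE x a) = wcor (wι x) a := by
  have : (ContinuousLinearMap.compL ℂ Wiener Wiener Wiener wι) ∘L wcorE = wcor ∘L wι :=
    wiener_ext₂ fun k p => by
      simp only [ContinuousLinearMap.comp_apply, ContinuousLinearMap.compL_apply, wι_wδ, map_smul,
        _root_.smul_apply, wcor_wδ]
      rw [wcorE, lsum₂_wδ]
      split_ifs
      · rw [map_smul, wι_wδ, smul_smul, mul_right_comm,
          mul_inv_cancel₀ (natCast_add_one_ne _), one_mul]
      · simp
  exact DFunLike.congr_fun (DFunLike.congr_fun this x) a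

theorem incl_wcor (u a : Wiener) : incl (wcor u a) = hΓ u (incl a) := by
  have : (ContinuousLinearMap.compL ℂ Wiener Wiener Hardy incl) ∘L wcor
      = ((ContinuousLinearMap.compL ℂ Wiener Hardy Hardy).flip incl) ∘L hΓ :=
    wiener_ext₂ fun k p => by
      simp only [ContinuousLinearMap.comp_apply, ContinuousLinearMap.compL_apply,
        ContinuousLinearMap.flip_apply, wcor_wδ, incl_wδ, hΓ_wδ_hδ]
      split_ifs <;> simp
  exact DFunLike.congr_fun (DFunLike.congr_fun this u) a

theorem hΓ_incl (u a : Wiener) : hΓ u (incl a) = hN a (incl u) := by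
  have : ((ContinuousLinearMap.compL ℂ Wiener Hardy Hardy).flip incl) ∘L hΓ
      = (((ContinuousLinearMap.compL ℂ Wiener Hardy Hardy).flip incl) ∘L hN).flip :=
    wiener_ext₂ fun k p => by
      simp [hΓ_wδ_hδ, hN_wδ_hδ]
  exact DFunLike.congr_fun (DFunLike.congr_fun this u) a

theorem hΓ_wcor (u a : Wiener) : hΓ (wcor u a) = hΓ u ∘L hM a := by
  have : (ContinuousLinearMap.compL ℂ Wiener Wiener (Hardy →L[ℂ] Hardy) hΓ) ∘L wcor
      = ((ContinuousLinearMap.compL ℂ Wiener (Hardy →L[ℂ] Hardy) (Hardy →L[ℂ] Hardy)).flip hM)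
        ∘L (ContinuousLinearMap.compL ℂ Hardy Hardy Hardy) ∘L hΓ :=
    wiener_ext₂ fun k p => hardy_ext fun q => by
      simp only [ContinuousLinearMap.comp_apply, ContinuousLinearMap.compL_apply,
        ContinuousLinearMap.flip_apply, wcor_wδ, hM_wδ_hδ, hΓ_wδ_hδ]
      split_ifs <;> try simp [hΓ_wδ_hδ]
      · rw [if_pos (by omega)]; congr 1; omega
      · omega
      · omega
  exact DFunLike.congr_fun (DFunLike.congr_fun this u) a

theorem hΓ_comp_hM (u a : Wiener) : hΓ u ∘L hM a = hN a ∘L hΓ u := by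
  have : ((ContinuousLinearMap.compL ℂ Wiener (Hardy →L[ℂ] Hardy) (Hardy →L[ℂ] Hardy)).flip hM)
        ∘L (ContinuousLinearMap.compL ℂ Hardy Hardy Hardy) ∘L hΓ
      = (((ContinuousLinearMap.compL ℂ Wiener (Hardy →L[ℂ] Hardy) (Hardy →L[ℂ] Hardy)).flip hΓ)
        ∘L (ContinuousLinearMap.compL ℂ Hardy Hardy Hardy) ∘L hN).flip :=
    wiener_ext₂ fun k p => hardy_ext fun q => by
      simp only [ContinuousLinearMap.comp_apply, ContinuousLinearMap.compL_apply,
        ContinuousLinearMap.flip_apply, hM_wδ_hδ, hΓ_wδ_hδ]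
      split_ifs <;> try simp [hN_wδ_hδ]
      · rw [if_pos (by omega)]; congr 1; omega
      · omega
      · omega
  exact DFunLike.congr_fun (DFunLike.congr_fun this u) a

theorem wmul_comm (a b : Wiener) : wmul a b = wmul b a := by
  have : wmul = wmul.flip := wiener_ext₂ fun k p => by
    rw [ContinuousLinearMap.flip_apply, wmul_wδ, wmul_wδ, add_comm]
  exact DFunLike.congr_fun (DFunLike.congr_fun this a) b

theorem incl_wmul (a b : Wiener) : incl (wmul a b) = hM a (incl b) := by
  have : (ContinuousLinearMap.compL ℂ Wiener Wiener Hardy incl) ∘L wmul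
      = ((ContinuousLinearMap.compL ℂ Wiener Hardy Hardy).flip incl) ∘L hM :=
    wiener_ext₂ fun k p => by
      simp [wmul_wδ, hM_wδ_hδ]
  exact DFunLike.congr_fun (DFunLike.congr_fun this a) b

theorem wmul_apply (a b : Wiener) (n : ℕ) :
    wmul a b n = ∑ p ∈ Finset.range (n + 1), a p * b (n - p) := by
  have : (ContinuousLinearMap.compL ℂ Wiener Wiener ℂ (wcoord n)) ∘L wmul
      = ∑ p ∈ Finset.range (n + 1), (wcoord p).smulRight (wcoord (n - p)) :=
    wiener_ext₂ fun k j => by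
      simp only [ContinuousLinearMap.comp_apply, ContinuousLinearMap.compL_apply, wmul_wδ,
        wcoord_apply, _root_.sum_apply, ContinuousLinearMap.smulRight_apply,
        _root_.smul_apply, smul_eq_mul, wδ_apply]
      split_ifs with h
      · rw [Finset.sum_eq_single k]
        · rw [if_pos rfl, if_pos (by omega), one_mul]
        · intro p _ hp
          rw [if_neg hp, zero_mul]
        · intro hk
          rw [Finset.mem_range] at hk
          omega
      · refine (Finset.sum_eq_zero fun p hp => ?_).symm
        rw [Finset.mem_range] at hp
        split_ifs <;> first | omega | simp
  have h := DFunLike.congr_fun (DFunLike.congr_fun this a) b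
  simpa [_root_.sum_apply] using h

/-- The product in the weighted coordinates. -/
def emul : Wiener →L[ℂ] Wiener →L[ℂ] Wiener :=
  ((ContinuousLinearMap.compL ℂ Wiener Wiener Wiener).flip wι) ∘L wmul + wmul ∘L wι
    - ((ContinuousLinearMap.compL ℂ Wiener Wiener Wiener).flip wι) ∘L wmul ∘L wι

theorem emul_apply (x x' : Wiener) :
    emul x x' = wmul x (wι x') + wmul (wι x) x' - wmul (wι x) (wι x') := rfl

theorem wι_emul (x x' : Wiener) : wι (emul x x') = wmul (wι x) (wι x') := by
  have : (ContinuousLinearMap.compL ℂ Wiener Wiener Wiener wι) ∘L emul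
      = ((ContinuousLinearMap.compL ℂ Wiener Wiener Wiener).flip wι) ∘L wmul ∘L wι :=
    wiener_ext₂ fun k p => by
      simp only [ContinuousLinearMap.comp_apply, ContinuousLinearMap.compL_apply,
        ContinuousLinearMap.flip_apply, emul_apply, wι_wδ, map_smul, wmul_wδ,
        _root_.smul_apply, smul_smul, ← add_smul, ← sub_smul]
      congr 1
      have h1 := natCast_add_one_ne k
      have h2 := natCast_add_one_ne p
      have h3 := natCast_add_one_ne (k + p)
      push_cast at h3 ⊢
      field_simp
      ring
  exact DFunLike.congr_fun (DFunLike.congr_fun this x) x'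

end Operators

section Identities

theorem hΓ_hδ_apply (u : Wiener) (q n : ℕ) : hΓ u (hδ q) n = u (n + q) := by
  have : (hcoord n) ∘L (hΓ.flip (hδ q)) = wcoord (n + q) := wiener_ext fun k => by
    simp only [ContinuousLinearMap.comp_apply, ContinuousLinearMap.flip_apply, hΓ_wδ_hδ,
      hcoord_apply, wcoord_apply, wδ_apply]
    split_ifs with h1 h2 h2
    · rw [hδ_apply, if_pos (by omega)]
    · rw [hδ_apply, if_neg (by omega)]
    · omega
    · rfl
  exact DFunLike.congr_fun this u

theorem hasSum_hΓ (u : Wiener) (h : Hardy) (n : ℕ) :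
    HasSum (fun p => u (n + p) * h p) (hΓ u h n) := by
  have h1 : HasSum _ (hΓ u h n) := ((hcoord n) ∘L hΓ u).hasSum (hasSum_smul_hδ h)
  convert h1 using 2 with p
  simp [hΓ_hδ_apply, mul_comm]

theorem hΓ_wδ_zero (h : Hardy) : hΓ (wδ 0) h = h 0 • hδ 0 := by
  have : hΓ (wδ 0) = (hcoord 0).smulRight (hδ 0) := hardy_ext fun q => by
    rw [hΓ_wδ_hδ, ContinuousLinearMap.smulRight_apply, hcoord_apply, hδ_apply]
    by_cases hq : q = 0 <;> simp [hq, eq_comm]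
  rw [this]
  rfl

theorem hM_comm (a b : Wiener) (h : Hardy) : hM a (hM b h) = hM b (hM a h) := by
  have : ((ContinuousLinearMap.compL ℂ Wiener (Hardy →L[ℂ] Hardy) (Hardy →L[ℂ] Hardy)).flip hM)
        ∘L (ContinuousLinearMap.compL ℂ Hardy Hardy Hardy) ∘L hM
      = (((ContinuousLinearMap.compL ℂ Wiener (Hardy →L[ℂ] Hardy) (Hardy →L[ℂ] Hardy)).flip hM)
        ∘L (ContinuousLinearMap.compL ℂ Hardy Hardy Hardy) ∘L hM).flip :=
    wiener_ext₂ fun k p => hardy_ext fun q => by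
      simp [hM_wδ_hδ, add_left_comm]
  exact DFunLike.congr_fun (DFunLike.congr_fun (DFunLike.congr_fun this a) b) h

theorem hM_hS (a : Wiener) (h : Hardy) : hM a (hS h) = hS (hM a h) := by
  simpa [hM_wδ] using hM_comm a (wδ 1) h

theorem hM_hδ_zero (a : Wiener) : hM a (hδ 0) = incl a := by
  have : hM.flip (hδ 0) = incl := wiener_ext fun k => by simp [hM_wδ_hδ]
  exact DFunLike.congr_fun this a

theorem hN_hδ_zero (a : Wiener) : hN a (hδ 0) = a 0 • hδ 0 := by
  have : hN.flip (hδ 0) = (wcoord 0).smulRight (hδ 0) := wiener_ext fun k => by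
    rw [ContinuousLinearMap.flip_apply, hN_wδ_hδ, ContinuousLinearMap.smulRight_apply, wcoord_apply,
      wδ_apply]
    by_cases hk : k = 0 <;> simp [hk, eq_comm]
  exact DFunLike.congr_fun this a

theorem hSb_hM (a : Wiener) (h : Hardy) :
    hSb (hM a h) = hM a (hSb h) + h 0 • hSb (incl a) := by
  have : (ContinuousLinearMap.compL ℂ Hardy Hardy Hardy hSb) ∘L hM
      = ((ContinuousLinearMap.compL ℂ Hardy Hardy Hardy).flip hSb) ∘L hM
        + (ContinuousLinearMap.smulRightL ℂ Hardy Hardy (hcoord 0)) ∘L hSb ∘L incl :=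
    wiener_ext fun k => hardy_ext fun q => by
      simp only [ContinuousLinearMap.comp_apply, ContinuousLinearMap.compL_apply,
        ContinuousLinearMap.flip_apply, hM_wδ_hδ, _root_.add_apply, incl_wδ, hSb_hδ,
        ContinuousLinearMap.smulRightL_apply_apply, ContinuousLinearMap.smulRight_apply,
        hcoord_apply, hδ_apply]
      rcases q with _ | q
      · simp
      · rw [if_neg (by omega), if_neg (by omega), if_neg (by omega), zero_smul, add_zero, hM_wδ_hδ]
        rfl
  exact DFunLike.congr_fun (DFunLike.congr_fun this a) h

/-- Symbols of products: the Leibniz rule for Hankel operators. -/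
theorem hΓ_wmul (f g : Wiener) (h : Hardy) :
    hΓ (wmul f g) h = hM f (hΓ g h) + hΓ f (hN g h) - (hN g h) 0 • incl f := by
  have key : ∀ q, hΓ.flip (hδ q) ∘L wmul.flip g = hM.flip (hΓ g (hδ q)) + hΓ.flip (hN g (hδ q))
      - (hN g (hδ q) 0) • incl := by
    intro q
    have : ((ContinuousLinearMap.compL ℂ Wiener Wiener Hardy (hΓ.flip (hδ q))) ∘L wmul.flip)
        = hM.flip ∘L (hΓ.flip (hδ q)) + hΓ.flip ∘L (hN.flip (hδ q))
          - (ContinuousLinearMap.smulRightL ℂ Wiener (Wiener →L[ℂ] Hardy)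
            (hcoord 0 ∘L hN.flip (hδ q))) incl :=
      wiener_ext₂ fun j i => by
        simp only [ContinuousLinearMap.comp_apply, ContinuousLinearMap.compL_apply,
          ContinuousLinearMap.flip_apply, _root_.add_apply, _root_.sub_apply, wmul_wδ, hΓ_wδ_hδ,
          hN_wδ_hδ, ContinuousLinearMap.smulRightL_apply_apply,
          ContinuousLinearMap.smulRight_apply, hcoord_apply, _root_.smul_apply, incl_wδ]
        rcases lt_trichotomy q j with h | rfl | h
        · rw [if_pos (by omega), if_pos (by omega), if_neg (by omega), hM_wδ_hδ,
            show i + j - q = i + (j - q) by omega]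
          simp
        · simp [hM_wδ_hδ, hΓ_wδ_hδ, hδ_apply]
        · rw [if_neg (show ¬ q ≤ j by omega), if_pos h.le, hΓ_wδ_hδ, hδ_apply,
            if_neg (show ¬ 0 = q - j by omega), map_zero, zero_add, zero_smul, sub_zero]
          split_ifs
          · congr 1; omega
          · omega
          · omega
          · rfl
    exact DFunLike.congr_fun this g
  have : hΓ (wmul f g) = hM f ∘L hΓ g + hΓ f ∘L hN g - (hcoord 0 ∘L hN g).smulRight (incl f) :=
    hardy_ext fun q => DFunLike.congr_fun (key q) f
  exact DFunLike.congr_fun this h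

theorem adjoint_eq_of_hδ {A B : Hardy →L[ℂ] Hardy}
    (h : ∀ p q, A (hδ p) q = conj (B (hδ q) p)) : ContinuousLinearMap.adjoint A = B :=
  hardy_ext fun q => by
    ext p
    rw [← inner_hδ_left, ContinuousLinearMap.adjoint_inner_right, inner_hδ_right, h,
      Complex.conj_conj]

theorem adjoint_eq_of_wδ {F G : Wiener →L[ℂ] Hardy →L[ℂ] Hardy}
    (h : ∀ k, ContinuousLinearMap.adjoint (F (wδ k)) = G (wδ k)) (a : Wiener) :
    ContinuousLinearMap.adjoint (F a) = G (star a) := by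
  have h1 : HasSum (fun k => star (a k • F (wδ k))) (star (F a)) := by
    refine HasSum.star ?_
    simpa using F.hasSum (hasSum_smul_wδ a)
  have h2 : HasSum (fun k => star a k • G (wδ k)) (G (star a)) := by
    simpa using G.hasSum (hasSum_smul_wδ (star a))
  refine h1.unique ?_
  convert h2 using 2 with k
  rw [star_smul, ContinuousLinearMap.star_eq_adjoint, h, lp.star_apply]

theorem adjoint_hM (a : Wiener) : ContinuousLinearMap.adjoint (hM a) = hN (star a) :=
  adjoint_eq_of_wδ (fun k => adjoint_eq_of_hδ fun p q => by
    rw [hM_wδ_hδ, hN_wδ_hδ, hδ_apply]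
    split_ifs with h1 h2 h2
    · rw [hδ_apply, if_pos (by omega), map_one]
    · omega
    · rw [hδ_apply, if_neg (by omega), map_zero]
    · simp) a

theorem adjoint_hΓ (a : Wiener) : ContinuousLinearMap.adjoint (hΓ a) = hΓ (star a) :=
  adjoint_eq_of_wδ (fun k => adjoint_eq_of_hδ fun p q => by
    rw [hΓ_hδ_apply, hΓ_hδ_apply, wδ_apply, wδ_apply, add_comm]
    split_ifs <;> simp) a

theorem star_apply_eq {F : Wiener →L[ℂ] Hardy →L[ℂ] Hardy}
    (h : ∀ k q, star (F (wδ k) (hδ q)) = F (wδ k) (hδ q)) (a : Wiener) (x : Hardy) :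
    star (F a x) = F (star a) (star x) := by
  have h0 : ∀ k, star (F (wδ k) x) = F (wδ k) (star x) := by
    intro k
    have h1 := ((F (wδ k)).hasSum (hasSum_smul_hδ x)).star
    refine h1.unique ?_
    convert (F (wδ k)).hasSum (hasSum_smul_hδ (star x)) using 2 with q
    rw [map_smul, map_smul, star_smul, h, lp.star_apply]
  have h1 := ((F.flip x).hasSum (hasSum_smul_wδ a)).star
  have h2 : HasSum _ (F (star a) (star x)) :=
    (F.flip (star x)).hasSum (hasSum_smul_wδ (star a))
  refine h1.unique ?_
  convert h2 using 2 with q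
  rw [map_smul, map_smul, star_smul, lp.star_apply]
  exact congrArg _ (h0 q)

theorem star_hΓ (a : Wiener) (x : Hardy) : star (hΓ a x) = hΓ (star a) (star x) :=
  star_apply_eq (fun k q => by rw [hΓ_wδ_hδ]; split_ifs <;> simp) a x

theorem hN_hSb (a : Wiener) (h : Hardy) : hN a (hSb h) = hSb (hN a h) := by
  have h1 : hN a = ContinuousLinearMap.adjoint (hM (star a)) := by rw [adjoint_hM, star_star]
  have h2 : hM (star a) ∘L hS = hS ∘L hM (star a) :=
    ContinuousLinearMap.ext fun x => hM_hS (star a) x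
  have h3 := congrArg ContinuousLinearMap.adjoint h2
  rw [ContinuousLinearMap.adjoint_comp, ContinuousLinearMap.adjoint_comp, ← h1] at h3
  exact (DFunLike.congr_fun h3 h).symm

end Identities

section Nice

variable {E F G H : Type*} [NormedAddCommGroup E] [NormedSpace ℝ E]
  [NormedAddCommGroup F] [NormedSpace ℝ F] [NormedAddCommGroup G] [NormedSpace ℝ G]
  [NormedAddCommGroup H] [NormedSpace ℝ H]

/-- Smooth maps which are bounded and Lipschitz on bounded sets. -/
def IsNice (f : E → F) : Prop :=
  ContDiff ℝ (⊤ : ℕ∞) f ∧ ∀ R : ℝ, ∃ K : ℝ, 0 ≤ K ∧ (∀ x, ‖x‖ ≤ R → ‖f x‖ ≤ K) ∧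
    ∀ x x', ‖x‖ ≤ R → ‖x'‖ ≤ R → ‖f x - f x'‖ ≤ K * ‖x - x'‖

theorem isNice_const (c : F) : IsNice fun _ : E => c :=
  ⟨contDiff_const, fun _ => ⟨‖c‖, norm_nonneg _, fun _ _ => le_rfl, fun _ _ _ _ => by
    rw [sub_self, norm_zero]; positivity⟩⟩

theorem isNice_id : IsNice fun x : E => x :=
  ⟨contDiff_id, fun R => ⟨max R 1, by positivity, fun _ h => h.trans (le_max_left _ _),
    fun _ _ _ _ => le_mul_of_one_le_left (norm_nonneg _) (le_max_right _ _)⟩⟩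

theorem IsNice.add {f g : E → F} (hf : IsNice f) (hg : IsNice g) :
    IsNice fun x => f x + g x := by
  refine ⟨hf.1.add hg.1, fun R => ?_⟩
  obtain ⟨K, hK, hb, hl⟩ := hf.2 R
  obtain ⟨K', hK', hb', hl'⟩ := hg.2 R
  refine ⟨K + K', by positivity, fun x hx => norm_add_le_of_le (hb x hx) (hb' x hx),
    fun x x' hx hx' => ?_⟩
  rw [add_sub_add_comm, add_mul]
  exact norm_add_le_of_le (hl x x' hx hx') (hl' x x' hx hx')

theorem IsNice.clm_apply (A : F →L[ℝ] G) {f : E → F} (hf : IsNice f) :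
    IsNice fun x => A (f x) := by
  refine ⟨A.contDiff.comp hf.1, fun R => ?_⟩
  obtain ⟨K, hK, hb, hl⟩ := hf.2 R
  refine ⟨‖A‖ * K, by positivity, fun x hx => A.le_opNorm_of_le (hb x hx),
    fun x x' hx hx' => ?_⟩
  rw [← map_sub, mul_assoc]
  exact A.le_opNorm_of_le (hl x x' hx hx')

theorem IsNice.bilin (B : F →L[ℝ] G →L[ℝ] H) {f : E → F} {g : E → G} (hf : IsNice f)
    (hg : IsNice g) : IsNice fun x => B (f x) (g x) := by
  refine ⟨(B.contDiff.comp hf.1).clm_apply hg.1, fun R => ?_⟩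
  obtain ⟨K, hK, hb, hl⟩ := hf.2 R
  obtain ⟨K', hK', hb', hl'⟩ := hg.2 R
  refine ⟨‖B‖ * K * K' * 2, by positivity, fun x hx => ?_, fun x x' hx hx' => ?_⟩
  · refine (B.le_opNorm₂ _ _).trans ?_
    have h1 := hb x hx
    have h2 := hb' x hx
    calc ‖B‖ * ‖f x‖ * ‖g x‖ ≤ ‖B‖ * K * K' := by gcongr
      _ ≤ ‖B‖ * K * K' * 2 := le_mul_of_one_le_right (by positivity) one_le_two
  · have e : B (f x) (g x) - B (f x') (g x') = B (f x - f x') (g x) + B (f x') (g x - g x') := by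
      simp
    have h1 := hl x x' hx hx'
    have h2 := hl' x x' hx hx'
    have h3 := hb' x hx
    have h4 := hb x' hx'
    rw [e]
    calc _ ≤ ‖B‖ * (K * ‖x - x'‖) * K' + ‖B‖ * K * (K' * ‖x - x'‖) := by
          refine norm_add_le_of_le ((B.le_opNorm₂ _ _).trans ?_) ((B.le_opNorm₂ _ _).trans ?_)
          · gcongr
          · gcongr
      _ = _ := by ring

theorem IsNice.ringInverse {A : Type*} [NormedRing A] [NormedAlgebra ℝ A] [HasSummableGeomSeries A]
    {f : E → A} (hf : IsNice f) (hu : ∀ x, IsUnit (f x)) (hb : ∀ x, ‖Ring.inverse (f x)‖ ≤ 1) :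
    IsNice fun x => Ring.inverse (f x) := by
  refine ⟨contDiff_iff_contDiffAt.2 fun x => ?_, fun R => ?_⟩
  · obtain ⟨v, hv⟩ := hu x
    have h1 := contDiffAt_ringInverse ℝ (n := (⊤ : ℕ∞)) v
    rw [hv] at h1
    exact h1.comp x hf.1.contDiffAt
  · obtain ⟨K, hK, -, hl⟩ := hf.2 R
    refine ⟨max K 1, by positivity, fun x _ => (hb x).trans (le_max_right _ _),
      fun x x' hx hx' => ?_⟩
    have e : Ring.inverse (f x) - Ring.inverse (f x')
        = Ring.inverse (f x) * (f x' - f x) * Ring.inverse (f x') := by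
      rw [mul_sub, sub_mul, Ring.inverse_mul_cancel _ (hu x), mul_assoc,
        Ring.mul_inverse_cancel _ (hu x'), mul_one, one_mul]
    rw [e]
    have h1 := hl x' x hx' hx
    rw [norm_sub_rev x' x] at h1
    calc _ ≤ ‖Ring.inverse (f x)‖ * ‖f x' - f x‖ * ‖Ring.inverse (f x')‖ :=
          (norm_mul_le _ _).trans (mul_le_mul_of_nonneg_right (norm_mul_le _ _) (norm_nonneg _))
      _ ≤ 1 * (K * ‖x - x'‖) * 1 := by gcongr <;> exact hb _
      _ ≤ max K 1 * ‖x - x'‖ := by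
          rw [one_mul, mul_one]
          exact mul_le_mul_of_nonneg_right (le_max_left _ _) (norm_nonneg _)

end Nice

section ComplexNice

variable {E : Type*} [NormedAddCommGroup E] [NormedSpace ℝ E]
  {F G H : Type*} [NormedAddCommGroup F] [NormedSpace ℂ F] [NormedAddCommGroup G] [NormedSpace ℂ G]
  [NormedAddCommGroup H] [NormedSpace ℂ H] [NormedSpace ℝ F] [NormedSpace ℝ G] [NormedSpace ℝ H]
  [IsScalarTower ℝ ℂ F] [IsScalarTower ℝ ℂ G] [IsScalarTower ℝ ℂ H]

theorem IsNice.complex_clm_apply (A : F →L[ℂ] G) {f : E → F} (hf : IsNice f) :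
    IsNice fun x => A (f x) :=
  hf.clm_apply (A.restrictScalars ℝ)

theorem IsNice.complex_bilin (B : F →L[ℂ] G →L[ℂ] H) {f : E → F} {g : E → G} (hf : IsNice f)
    (hg : IsNice g) : IsNice fun x => B (f x) (g x) :=
  hf.bilin (B.bilinearRestrictScalars ℝ) hg

end ComplexNice

theorem isNice_star_wiener {E : Type*} [NormedAddCommGroup E] [NormedSpace ℝ E] {f : E → Wiener}
    (hf : IsNice f) : IsNice fun x => star (f x) :=
  hf.clm_apply (starL' ℝ : Wiener ≃L[ℝ] Wiener).toContinuousLinearMap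

theorem isNice_star_hardy {E : Type*} [NormedAddCommGroup E] [NormedSpace ℝ E] {f : E → Hardy}
    (hf : IsNice f) : IsNice fun x => star (f x) :=
  hf.clm_apply (starL' ℝ : Hardy ≃L[ℝ] Hardy).toContinuousLinearMap

section Resolvent

/-- The operator `I + y H_u²`. -/
def hQ (y : ℝ) (u : Wiener) : Hardy →L[ℂ] Hardy := 1 + (y : ℂ) • (hΓ u ∘L hΓ (star u))

theorem hQ_apply (y : ℝ) (u : Wiener) (h : Hardy) :
    hQ y u h = h + (y : ℂ) • hΓ u (hΓ (star u) h) := rfl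

theorem inner_hΓ_left (u : Wiener) (h g : Hardy) :
    inner ℂ (hΓ u h) g = inner ℂ h (hΓ (star u) g) := by
  rw [← adjoint_hΓ, ContinuousLinearMap.adjoint_inner_right]

theorem inner_hQ_self (y : ℝ) (u : Wiener) (h : Hardy) :
    inner ℂ (hQ y u h) h = ((‖h‖ ^ 2 + y * ‖hΓ (star u) h‖ ^ 2 : ℝ) : ℂ) := by
  rw [hQ_apply, inner_add_left, inner_smul_left, inner_hΓ_left, inner_self_eq_norm_sq_to_K,
    inner_self_eq_norm_sq_to_K]
  simp

theorem isUnit_hQ {y : ℝ} (hy : 0 < y) (u : Wiener) : IsUnit (hQ y u) := by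
  refine ContinuousLinearMap.isUnit_of_forall_le_norm_inner_map _ (c := 1) one_pos fun h => ?_
  rw [inner_hQ_self, Complex.norm_real, NNReal.coe_one, mul_one]
  refine le_trans ?_ (Real.le_norm_self _)
  have : 0 ≤ y * ‖hΓ (star u) h‖ ^ 2 := by positivity
  linarith

theorem norm_le_norm_hQ {y : ℝ} (hy : 0 < y) (u : Wiener) (h : Hardy) : ‖h‖ ≤ ‖hQ y u h‖ := by
  have h1 : ‖inner ℂ (hQ y u h) h‖ ≤ ‖hQ y u h‖ * ‖h‖ := norm_inner_le_norm _ _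
  rw [inner_hQ_self, Complex.norm_real, Real.norm_of_nonneg (by positivity)] at h1
  have : 0 ≤ y * ‖hΓ (star u) h‖ ^ 2 := by positivity
  rcases (norm_nonneg h).eq_or_lt with h0 | h0
  · rw [← h0]; positivity
  · nlinarith

theorem norm_inverse_hQ_le {y : ℝ} (hy : 0 < y) (u : Wiener) : ‖Ring.inverse (hQ y u)‖ ≤ 1 := by
  refine ContinuousLinearMap.opNorm_le_bound _ zero_le_one fun h => ?_
  rw [one_mul]
  refine (norm_le_norm_hQ hy u _).trans_eq ?_
  rw [← mul_apply_eq_comp, Ring.mul_inverse_cancel _ (isUnit_hQ hy u)]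
  rfl

/-- The resolvent vector `w^y = (I + y H_u²)⁻¹(1)` in the Hardy space. -/
def hw (y : ℝ) (u : Wiener) : Hardy := Ring.inverse (hQ y u) (hδ 0)

theorem hQ_hw {y : ℝ} (hy : 0 < y) (u : Wiener) : hQ y u (hw y u) = hδ 0 := by
  rw [hw, ← mul_apply_eq_comp, Ring.mul_inverse_cancel _ (isUnit_hQ hy u)]
  rfl

theorem eq_hw_of_hQ {y : ℝ} (hy : 0 < y) {u : Wiener} {w : Hardy} (h : hQ y u w = hδ 0) :
    w = hw y u := by
  rw [hw, ← h, ← mul_apply_eq_comp, Ring.inverse_mul_cancel _ (isUnit_hQ hy u)]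
  rfl

/-- `H_u w^y`, in the Wiener algebra. -/
def eZ₀ (y : ℝ) (x : Wiener) : Wiener := hG x (star (hw y (wι x)))

/-- `w^y`, in weighted coordinates. -/
def eW (y : ℝ) (x : Wiener) : Wiener := wδ 0 - (y : ℂ) • wcorE x (star (eZ₀ y x))

/-- `H_u w^y`, in weighted coordinates. -/
def eZ (y : ℝ) (x : Wiener) : Wiener := wcorE x (star (wι (eW y x)))

/-- The vector field of the hierarchy, in weighted coordinates. -/
def eX {m : ℕ} (y a : Fin m → ℝ) (x : Wiener) : Wiener :=
  ∑ k, (2 * Complex.I * (y k : ℂ) * (a k : ℂ)) • emul (eW (y k) x) (eZ (y k) x)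

theorem wι_wδ_zero : wι (wδ 0) = wδ 0 := by simp

theorem incl_eZ₀ (y : ℝ) (x : Wiener) : incl (eZ₀ y x) = hΓ (wι x) (star (hw y (wι x))) :=
  incl_hG _ _

theorem incl_wι_eW {y : ℝ} (hy : 0 < y) (x : Wiener) : incl (wι (eW y x)) = hw y (wι x) := by
  have h := hQ_hw hy (wι x)
  rw [hQ_apply] at h
  rw [eW, map_sub, map_sub, wι_wδ_zero, incl_wδ, map_smul, map_smul, wι_wcorE, incl_wcor,
    incl_star, incl_eZ₀, star_hΓ, star_star, ← h, add_sub_cancel_right]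

theorem wι_eZ {y : ℝ} (hy : 0 < y) (x : Wiener) : wι (eZ y x) = eZ₀ y x :=
  incl_injective <| by rw [eZ, wι_wcorE, incl_wcor, incl_star, incl_wι_eW hy, incl_eZ₀]

/-- The pair `(w, Z) = (w^y, H_u w^y)` in the Wiener algebra. -/
def IsResolventPair (y : ℝ) (u w Z : Wiener) : Prop :=
  Z = wcor u (star w) ∧ w = wδ 0 - (y : ℂ) • wcor u (star Z)

theorem isResolventPair_eW_eZ {y : ℝ} (hy : 0 < y) (x : Wiener) :
    IsResolventPair y (wι x) (wι (eW y x)) (wι (eZ y x)) := by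
  refine ⟨by rw [eZ, wι_wcorE], ?_⟩
  rw [wι_eZ hy, eW, map_sub, map_smul, wι_wδ_zero, wι_wcorE]

theorem isNice_hw {y : ℝ} (hy : 0 < y) : IsNice fun x : Wiener => hw y (wι x) := by
  have h1 : IsNice fun x : Wiener => hQ y (wι x) := by
    refine (isNice_const _).add (IsNice.complex_clm_apply
      ((y : ℂ) • ContinuousLinearMap.id ℂ (Hardy →L[ℂ] Hardy)) ?_)
    have hx : IsNice fun x : Wiener => wι x := isNice_id.complex_clm_apply wι
    exact IsNice.complex_bilin (ContinuousLinearMap.compL ℂ Hardy Hardy Hardy)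
      (hx.complex_clm_apply hΓ) ((isNice_star_wiener hx).complex_clm_apply hΓ)
  have h2 := h1.ringInverse (fun x => isUnit_hQ hy _) (fun x => norm_inverse_hQ_le hy _)
  exact h2.complex_clm_apply (ContinuousLinearMap.apply ℂ Hardy (hδ 0))

theorem isNice_eZ₀ {y : ℝ} (hy : 0 < y) : IsNice (eZ₀ y) :=
  isNice_id.complex_bilin hG (isNice_star_hardy (isNice_hw hy))

theorem isNice_eW {y : ℝ} (hy : 0 < y) : IsNice (eW y) := by
  have h1 := (isNice_id.complex_bilin wcorE (isNice_star_wiener (isNice_eZ₀ hy))).complex_clm_apply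
    ((-(y : ℂ)) • ContinuousLinearMap.id ℂ Wiener)
  convert (isNice_const (E := Wiener) (wδ 0)).add h1 using 2 with x
  rw [eW, sub_eq_add_neg, ← neg_smul]
  rfl

theorem isNice_eZ {y : ℝ} (hy : 0 < y) : IsNice (eZ y) :=
  isNice_id.complex_bilin wcorE (isNice_star_wiener ((isNice_eW hy).complex_clm_apply wι))

theorem isNice_eX {m : ℕ} {y : Fin m → ℝ} (hy : ∀ k, 0 < y k) (a : Fin m → ℝ) :
    IsNice (eX y a) := by
  suffices h : ∀ s : Finset (Fin m), IsNice fun x => ∑ k ∈ s,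
      (2 * Complex.I * (y k : ℂ) * (a k : ℂ)) • emul (eW (y k) x) (eZ (y k) x) from h Finset.univ
  intro s
  induction s using Finset.induction_on with
  | empty => simpa using isNice_const (0 : Wiener)
  | insert k s hk ih =>
    simp only [Finset.sum_insert hk]
    refine IsNice.add ?_ ih
    exact (IsNice.complex_bilin emul (isNice_eW (hy k)) (isNice_eZ (hy k))).complex_clm_apply
      ((2 * Complex.I * (y k : ℂ) * (a k : ℂ)) • ContinuousLinearMap.id ℂ Wiener)

end Resolvent

section Multipliers

theorem adjoint_hN (a : Wiener) : ContinuousLinearMap.adjoint (hN a) = hM (star a) := by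
  conv_lhs => rw [← star_star a, ← adjoint_hM, ContinuousLinearMap.adjoint_adjoint]

theorem hN_hM_shift (a b : Wiener) (h : Hardy) :
    hSb (hN a (hM b (hS h))) = hN a (hM b h) := by
  rw [hM_hS, ← hN_hSb, hSb_hS]

/-- A self-adjoint Toeplitz operator having `1` as an eigenvector is a homothety. -/
theorem eq_smul_of_toeplitz {T : Hardy →L[ℂ] Hardy} {c : ℂ}
    (hT : ∀ h, hSb (T (hS h)) = T h) (hs : ContinuousLinearMap.adjoint T = T)
    (h0 : T (hδ 0) = c • hδ 0) (h : Hardy) : T h = c • h := by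
  have hsym : ∀ p q, T (hδ p) q = conj (T (hδ q) p) := fun p q => by
    rw [← inner_hδ_left, ← inner_hδ_right, ← ContinuousLinearMap.adjoint_inner_left, hs]
  have hent : ∀ q n, T (hδ q) n = c * hδ q n := by
    intro q
    induction q with
    | zero => intro n; rw [h0]; rfl
    | succ q ih =>
      intro n
      cases n with
      | zero =>
        rw [hsym, h0]
        simp [hδ_apply]
      | succ n =>
        rw [← hS_hδ, ← hSb_apply, hT, ih, ← hSb_apply (hS (hδ q)), hSb_hS]
  have : T = c • ContinuousLinearMap.id ℂ Hardy := hardy_ext fun q => by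
    ext n
    exact hent q n
  rw [this]
  rfl

variable {y : ℝ} {u w Z : Wiener}

theorem incl_Z (hp : IsResolventPair y u w Z) : incl Z = hΓ u (incl (star w)) := by
  conv_lhs => rw [hp.1, incl_wcor]

theorem incl_w (hp : IsResolventPair y u w Z) :
    incl w = hδ 0 - (y : ℂ) • hΓ u (incl (star Z)) := by
  conv_lhs => rw [hp.2, map_sub, map_smul, incl_wcor, incl_wδ]

theorem hN_hM_add (hp : IsResolventPair y u w Z) (h : Hardy) :
    hN (star w) (hM w h) + (y : ℂ) • hN (star Z) (hM Z h) = conj (w 0) • h := by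
  set T : Hardy →L[ℂ] Hardy := hN (star w) ∘L hM w + (y : ℂ) • (hN (star Z) ∘L hM Z) with hTdef
  have hTa : ∀ h, T h = hN (star w) (hM w h) + (y : ℂ) • hN (star Z) (hM Z h) := fun _ => rfl
  rw [← hTa]
  refine eq_smul_of_toeplitz (fun h => ?_) ?_ ?_ h
  · rw [hTa, hTa, map_add, map_smul, hN_hM_shift, hN_hM_shift]
  · rw [hTdef, map_add, LinearIsometryEquiv.map_smulₛₗ, ContinuousLinearMap.adjoint_comp,
      ContinuousLinearMap.adjoint_comp, adjoint_hM, adjoint_hM, adjoint_hN, adjoint_hN, star_star,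
      star_star, starRingEnd_apply, Complex.star_def, Complex.conj_ofReal]
  · have e1 : hN (star w) (hΓ u (incl (star Z))) = hN (star Z) (hΓ u (incl (star w))) := by
      have h1 := DFunLike.congr_fun (hΓ_comp_hM u (star w)) (incl (star Z))
      have h2 := DFunLike.congr_fun (hΓ_comp_hM u (star Z)) (incl (star w))
      simp only [ContinuousLinearMap.comp_apply, ← incl_wmul] at h1 h2
      rw [← h1, ← h2, wmul_comm]
    rw [hTa, hM_hδ_zero, hM_hδ_zero, incl_w hp, map_sub, map_smul, e1, ← incl_Z hp, hN_hδ_zero,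
      lp.star_apply, sub_add_cancel, Complex.star_def]

theorem norm_hM_sq_add (hp : IsResolventPair y u w Z) (hy : 0 < y) (h : Hardy) :
    ‖hM w h‖ ^ 2 + y * ‖hM Z h‖ ^ 2 ≤ ‖h‖ ^ 2 := by
  have key : ∀ h, ((‖hM w h‖ ^ 2 + y * ‖hM Z h‖ ^ 2 : ℝ) : ℂ) = w 0 * (‖h‖ ^ 2 : ℝ) := by
    intro h
    have h1 := congrArg (fun z => inner ℂ z h) (hN_hM_add hp h)
    simp only [inner_add_left, inner_smul_left, ← adjoint_hM, ContinuousLinearMap.adjoint_inner_left,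
      inner_self_eq_norm_sq_to_K] at h1
    simpa using h1
  have h0 := key (hδ 0)
  rw [norm_hδ, one_pow, Complex.ofReal_one, mul_one, hM_hδ_zero, hM_hδ_zero] at h0
  set c : ℝ := ‖incl w‖ ^ 2 + y * ‖incl Z‖ ^ 2 with hc
  have hc0 : 0 ≤ c := by positivity
  have hc1 : c ≤ 1 := by
    have h2 : ‖w 0‖ ≤ ‖incl w‖ := by
      rw [← incl_apply]; exact lp.norm_apply_le_norm two_ne_zero _ _
    rw [← h0, Complex.norm_real, Real.norm_of_nonneg hc0] at h2
    have h3 : 0 ≤ y * ‖incl Z‖ ^ 2 := by positivity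
    nlinarith
  have h4 := key h
  rw [← h0] at h4
  have h5 : ‖hM w h‖ ^ 2 + y * ‖hM Z h‖ ^ 2 = c * ‖h‖ ^ 2 :=
    Complex.ofReal_injective (by rw [Complex.ofReal_mul]; exact h4)
  rw [h5]
  exact mul_le_of_le_one_left (by positivity) hc1

theorem norm_hM_w_le (hp : IsResolventPair y u w Z) (hy : 0 < y) : ‖hM w‖ ≤ 1 := by
  refine ContinuousLinearMap.opNorm_le_bound _ zero_le_one fun h => ?_
  have h1 := norm_hM_sq_add hp hy h
  have h2 : 0 ≤ y * ‖hM Z h‖ ^ 2 := by positivity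
  rw [one_mul]
  exact abs_le_of_sq_le_sq' (by linarith) (norm_nonneg _) |>.2

theorem norm_hM_Z_le (hp : IsResolventPair y u w Z) (hy : 0 < y) : ‖hM Z‖ ≤ (√y)⁻¹ := by
  refine ContinuousLinearMap.opNorm_le_bound _ (by positivity) fun h => ?_
  have h1 := norm_hM_sq_add hp hy h
  have h2 : 0 ≤ ‖hM w h‖ ^ 2 := by positivity
  rw [← div_eq_inv_mul, le_div_iff₀ (by positivity)]
  refine abs_le_of_sq_le_sq' ?_ (norm_nonneg _) |>.2
  rw [mul_pow, Real.sq_sqrt hy.le]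
  linarith

theorem norm_hN_star (a : Wiener) : ‖hN (star a)‖ = ‖hM a‖ := by
  rw [← adjoint_hM, LinearIsometryEquiv.norm_map]

open scoped ENNReal in
theorem tsum_sq_weight (f : ℕ → ℝ≥0∞) :
    ∑' n : ℕ, ((n : ℝ≥0∞) + 1) ^ 2 * f n = ∑' k : ℕ, (2 * k + 1 : ℝ≥0∞) * ∑' n, f (n + k) := by
  have h1 : ∀ n : ℕ, ((n : ℝ≥0∞) + 1) ^ 2 * f n
      = ∑' k : ℕ, (2 * k + 1 : ℝ≥0∞) * (if k ≤ n then f n else 0) := by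
    intro n
    rw [tsum_eq_sum (s := Finset.range (n + 1)) fun k hk => by
      rw [Finset.mem_range] at hk
      rw [if_neg (by omega), mul_zero]]
    have h3 : ∑ k ∈ Finset.range (n + 1), (2 * k + 1 : ℝ≥0∞) * (if k ≤ n then f n else 0)
        = ∑ k ∈ Finset.range (n + 1), (2 * k + 1 : ℝ≥0∞) * f n :=
      Finset.sum_congr rfl fun k hk => by
        rw [if_pos (Nat.lt_succ_iff.1 (Finset.mem_range.1 hk))]
    rw [h3, ← Finset.sum_mul]
    congr 1
    have h2 : ∀ n : ℕ, ∑ k ∈ Finset.range (n + 1), (2 * k + 1) = (n + 1) ^ 2 := by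
      intro n
      induction n with
      | zero => simp
      | succ n ih => rw [Finset.sum_range_succ, ih]; ring
    exact_mod_cast (h2 n).symm
  simp_rw [h1]
  rw [ENNReal.tsum_comm]
  refine tsum_congr fun k => ?_
  rw [ENNReal.tsum_mul_left]
  congr 1
  rw [← ENNReal.summable.sum_add_tsum_nat_add' (k := k), Finset.sum_eq_zero, zero_add]
  · simp
  · intro n hn
    rw [Finset.mem_range] at hn
    rw [if_neg (by omega)]

open scoped ENNReal in
theorem ofReal_norm_sq (h : Hardy) : ENNReal.ofReal (‖h‖ ^ 2) = ∑' n, ENNReal.ofReal (‖h n‖ ^ 2) := by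
  rw [← (hardy_hasSum_sq h).tsum_eq,
    ENNReal.ofReal_tsum_of_nonneg (fun _ => by positivity) (hardy_hasSum_sq h).summable]

open scoped ENNReal in
theorem ofReal_norm_incl_sq (x : Wiener) : ENNReal.ofReal (‖incl x‖ ^ 2)
    = ∑' k : ℕ, (2 * k + 1 : ℝ≥0∞) * ENNReal.ofReal (‖(hSb ^ k) (incl (wι x))‖ ^ 2) := by
  simp_rw [ofReal_norm_sq, hSb_pow_apply]
  rw [← tsum_sq_weight fun n => ENNReal.ofReal (‖incl (wι x) n‖ ^ 2)]
  refine tsum_congr fun n => ?_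
  rw [incl_apply, incl_apply, wι_apply, norm_mul, norm_inv, natCast_add_one_norm,
    show ((n : ℝ≥0∞) + 1) ^ 2 = ENNReal.ofReal (((n : ℝ) + 1) ^ 2) by
      rw [ENNReal.ofReal_pow (by positivity), ENNReal.ofReal_add (by positivity) zero_le_one]
      simp,
    ← ENNReal.ofReal_mul (by positivity), mul_pow, ← mul_assoc, ← mul_pow,
    mul_inv_cancel₀ (by positivity), one_pow, one_mul]

theorem hN_hSb_pow (a : Wiener) (k : ℕ) (h : Hardy) : hN a ((hSb ^ k) h) = (hSb ^ k) (hN a h) := by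
  induction k with
  | zero => simp
  | succ k ih => rw [pow_succ', mul_apply_eq_comp, mul_apply_eq_comp, hN_hSb, ih]

/-- Operators commuting with the backward shift are bounded on `H¹₊` by their norm on `L²₊`. -/
theorem norm_incl_wcorE_le (x a : Wiener) : ‖incl (wcorE x a)‖ ≤ ‖hN a‖ * ‖incl x‖ := by
  refine abs_le_of_sq_le_sq' ?_ (by positivity) |>.2
  rw [← ENNReal.ofReal_le_ofReal_iff (by positivity), mul_pow, ENNReal.ofReal_mul (by positivity),
    ofReal_norm_incl_sq, ofReal_norm_incl_sq, ← ENNReal.tsum_mul_left]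
  refine ENNReal.tsum_le_tsum fun k => ?_
  rw [mul_left_comm, ← ENNReal.ofReal_mul (by positivity), wι_wcorE, incl_wcor, hΓ_incl,
    ← hN_hSb_pow, ← mul_pow]
  gcongr
  exact (hN a).le_opNorm _

theorem incl_emul (p q : Wiener) :
    incl (emul p q) = hM (wι q) (incl p) + hM (wι p) (incl q) - hM (wι p) (incl (wι q)) := by
  rw [emul_apply, map_sub, map_add, wmul_comm p, incl_wmul, incl_wmul, incl_wmul]

theorem norm_incl_wι_le (x : Wiener) : ‖incl (wι x)‖ ≤ ‖incl x‖ := by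
  refine abs_le_of_sq_le_sq' ?_ (norm_nonneg _) |>.2
  refine hasSum_le (fun n => ?_) (hardy_hasSum_sq _) (hardy_hasSum_sq _)
  rw [incl_apply, incl_apply, wι_apply, norm_mul, norm_inv, natCast_add_one_norm]
  gcongr
  exact mul_le_of_le_one_left (norm_nonneg _)
    (inv_le_one_of_one_le₀ (by norm_cast; omega))

theorem exists_norm_wι_le : ∃ C : ℝ, 0 ≤ C ∧ ∀ x : Wiener, ‖wι x‖ ≤ C * ‖incl x‖ := by
  have hs : Summable fun k : ℕ => ((k + 1 : ℝ)⁻¹) ^ 2 := by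
    have := (summable_nat_add_iff 1).2 (Real.summable_nat_pow_inv.2 one_lt_two)
    simpa using this
  refine ⟨√(∑' k : ℕ, ((k + 1 : ℝ)⁻¹) ^ 2), by positivity, fun x => ?_⟩
  rw [← (wiener_hasSum_norm (wι x)).tsum_eq]
  refine Real.tsum_le_of_sum_le (fun _ => norm_nonneg _) fun s => ?_
  refine abs_le_of_sq_le_sq' ?_ (by positivity) |>.2
  rw [mul_pow, Real.sq_sqrt (by positivity)]
  have h1 : ∀ k, ‖wι x k‖ = (k + 1 : ℝ)⁻¹ * ‖incl x k‖ := fun k => by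
    rw [wι_apply, norm_mul, norm_inv, natCast_add_one_norm, incl_apply]
  simp_rw [h1]
  refine (Finset.sum_mul_sq_le_sq_mul_sq _ _ _).trans ?_
  gcongr
  · exact hs.sum_le_tsum _ fun _ _ => by positivity
  · exact sum_le_hasSum _ (fun _ _ => by positivity) (hardy_hasSum_sq _)

end Multipliers

section Bounds

variable {y : ℝ}

theorem norm_incl_eZ_le (hy : 0 < y) (x : Wiener) : ‖incl (eZ y x)‖ ≤ ‖incl x‖ := by
  refine (norm_incl_wcorE_le _ _).trans ?_
  rw [norm_hN_star]
  exact mul_le_of_le_one_left (norm_nonneg _) (norm_hM_w_le (isResolventPair_eW_eZ hy x) hy)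

theorem norm_incl_eW_le (hy : 0 < y) (x : Wiener) : ‖incl (eW y x)‖ ≤ 1 + √y * ‖incl x‖ := by
  rw [eW, map_sub, map_smul, incl_wδ]
  refine (norm_sub_le _ _).trans ?_
  rw [norm_hδ, norm_smul, Complex.norm_real, Real.norm_of_nonneg hy.le]
  have h1 := norm_incl_wcorE_le x (star (eZ₀ y x))
  rw [norm_hN_star, ← wι_eZ hy] at h1
  have h2 := norm_hM_Z_le (isResolventPair_eW_eZ hy x) hy
  have h3 : y * (√y)⁻¹ = √y := by
    rw [← div_eq_mul_inv, Real.div_sqrt]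
  rw [← wι_eZ hy, ← h3, mul_assoc]
  gcongr
  exact h1.trans (by gcongr)

theorem norm_incl_emul_le (hy : 0 < y) (x : Wiener) : ‖incl (emul (eW y x) (eZ y x))‖ ≤ (√y)⁻¹ + 3 * ‖incl x‖ := by
  have hp := isResolventPair_eW_eZ hy x
  have hw := norm_hM_w_le hp hy
  have hZ := norm_hM_Z_le hp hy
  have hy' : (√y)⁻¹ * √y = 1 := inv_mul_cancel₀ (by positivity)
  have h1 : ‖hM (wι (eZ y x)) (incl (eW y x))‖ ≤ (√y)⁻¹ * (1 + √y * ‖incl x‖) :=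
    (ContinuousLinearMap.le_opNorm _ _).trans
      (mul_le_mul hZ (norm_incl_eW_le hy x) (norm_nonneg _) (by positivity))
  have h2 : ‖hM (wι (eW y x)) (incl (eZ y x))‖ ≤ 1 * ‖incl x‖ :=
    (ContinuousLinearMap.le_opNorm _ _).trans
      (mul_le_mul hw (norm_incl_eZ_le hy x) (norm_nonneg _) zero_le_one)
  have h3 : ‖hM (wι (eW y x)) (incl (wι (eZ y x)))‖ ≤ 1 * ‖incl x‖ :=
    (ContinuousLinearMap.le_opNorm _ _).trans
      (mul_le_mul hw ((norm_incl_wι_le _).trans (norm_incl_eZ_le hy x)) (norm_nonneg _) zero_le_one)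
  rw [mul_add, ← mul_assoc, hy', mul_one] at h1
  rw [incl_emul]
  refine (norm_sub_le _ _).trans ?_
  have := norm_add_le (hM (wι (eZ y x)) (incl (eW y x))) (hM (wι (eW y x)) (incl (eZ y x)))
  linarith

theorem exists_norm_emul_le (hy : 0 < y) (K : ℝ) : ∃ C : ℝ, 0 ≤ C ∧ ∀ x : Wiener, ‖incl x‖ ≤ K →
    ‖emul (eW y x) (eZ y x)‖ ≤ C * ‖x‖ + C := by
  obtain ⟨c, hc0, hc⟩ := exists_norm_wι_le
  set A := c * (1 + √y * |K|) with hA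
  set B := c * |K| with hB
  have hA0 : 0 ≤ A := by positivity
  have hB0 : 0 ≤ B := by positivity
  refine ⟨y * B * B + B + 2 * A * A, by positivity, fun x hx => ?_⟩
  have hx' : ‖incl x‖ ≤ |K| := hx.trans (le_abs_self K)
  have hw : ‖wι (eW y x)‖ ≤ A := (hc _).trans
    (by rw [hA]; gcongr; exact (norm_incl_eW_le hy x).trans (by gcongr))
  have hZ : ‖wι (eZ y x)‖ ≤ B := (hc _).trans
    (by rw [hB]; gcongr; exact (norm_incl_eZ_le hy x).trans hx')
  have h1 : ‖eZ y x‖ ≤ ‖x‖ * A := by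
    refine (norm_wcorE_le _ _).trans ?_
    rw [norm_star]
    gcongr
  have h2 : ‖eW y x‖ ≤ 1 + y * (‖x‖ * B) := by
    rw [eW]
    refine (norm_sub_le _ _).trans ?_
    rw [norm_wδ, norm_smul, Complex.norm_real, Real.norm_of_nonneg hy.le]
    gcongr
    refine (norm_wcorE_le _ _).trans ?_
    rw [norm_star, ← wι_eZ hy]
    gcongr
  have h3 : ‖wmul (eW y x) (wι (eZ y x))‖ ≤ (1 + y * (‖x‖ * B)) * B :=
    (norm_wmul_le _ _).trans (by gcongr)
  have h4 : ‖wmul (wι (eW y x)) (eZ y x)‖ ≤ A * (‖x‖ * A) :=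
    (norm_wmul_le _ _).trans (by gcongr)
  have h5 : ‖wmul (wι (eW y x)) (wι (eZ y x))‖ ≤ A * (‖x‖ * A) :=
    (norm_wmul_le _ _).trans (by gcongr; exact (norm_wι_le _).trans h1)
  rw [emul_apply]
  refine (norm_sub_le _ _).trans ?_
  have h6 := norm_add_le (wmul (eW y x) (wι (eZ y x))) (wmul (wι (eW y x)) (eZ y x))
  have h7 : 0 ≤ B * ‖x‖ := by positivity
  have h8 : 0 ≤ y * B * B := by positivity
  have h9 : 0 ≤ A * A := by positivity
  nlinarith

end Bounds

section GlobalExistence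

variable {m : ℕ} {y : Fin m → ℝ}

theorem exists_norm_incl_eX_le (hy : ∀ k, 0 < y k) (a : Fin m → ℝ) : ∃ C : ℝ, 0 ≤ C ∧ ∀ x : Wiener,
    ‖incl (eX y a x)‖ ≤ C * ‖incl x‖ + C := by
  refine ⟨∑ k, ‖2 * Complex.I * (y k : ℂ) * (a k : ℂ)‖ * ((√(y k))⁻¹ + 3), by positivity,
    fun x => ?_⟩
  rw [eX, map_sum, Finset.sum_mul, ← Finset.sum_add_distrib]
  refine (norm_sum_le _ _).trans (Finset.sum_le_sum fun k _ => ?_)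
  rw [map_smul, norm_smul, mul_assoc ‖_‖, ← mul_add]
  gcongr
  refine (norm_incl_emul_le (hy k) x).trans ?_
  have : 0 ≤ (√(y k))⁻¹ * ‖incl x‖ := by positivity
  linarith

theorem exists_norm_eX_le (hy : ∀ k, 0 < y k) (a : Fin m → ℝ) (K : ℝ) :
    ∃ C : ℝ, 0 ≤ C ∧ ∀ x : Wiener, ‖incl x‖ ≤ K →
    ‖eX y a x‖ ≤ C * ‖x‖ + C := by
  choose C hC0 hC using fun k => exists_norm_emul_le (hy k) K
  refine ⟨∑ k, ‖2 * Complex.I * (y k : ℂ) * (a k : ℂ)‖ * C k,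
    Finset.sum_nonneg fun k _ => mul_nonneg (norm_nonneg _) (hC0 k), fun x hx => ?_⟩
  rw [eX, Finset.sum_mul, ← Finset.sum_add_distrib]
  refine (norm_sum_le _ _).trans (Finset.sum_le_sum fun k _ => ?_)
  rw [norm_smul, mul_assoc ‖_‖, ← mul_add]
  gcongr
  exact hC k x hx

open Set Metric

theorem exists_solution_Icc (hy : ∀ k, 0 < y k) (a : Fin m → ℝ) {T : ℝ}
    (hT : 0 ≤ T) (x₀ : Wiener) : ∃ U : ℝ → Wiener, U 0 = x₀ ∧
    ∀ t ∈ Icc (-T) T, HasDerivWithinAt U (eX y a (U t)) (Icc (-T) T) t := by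
  refine exists_solution_Icc_of_apriori (f := fun _ => eX y a) hT (fun R => ?_)
    (fun _ => continuousOn_const) ?_
  · obtain ⟨K, hK0, -, hK⟩ := (isNice_eX hy a).2 R
    refine ⟨⟨K, hK0⟩, fun _ _ => LipschitzOnWith.of_dist_le_mul fun x hx x' hx' => ?_⟩
    rw [mem_closedBall_zero_iff] at hx hx'
    rw [dist_eq_norm, dist_eq_norm]
    exact hK x x' hx hx'
  · obtain ⟨C, hC0, hC⟩ := exists_norm_incl_eX_le hy a
    obtain ⟨R₁, hR₁, hgr₁⟩ := exists_gronwall_bound ‖x₀‖ C C T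
    obtain ⟨D, hD0, hD⟩ := exists_norm_eX_le hy a R₁
    obtain ⟨R₂, hR₂, hgr₂⟩ := exists_gronwall_bound ‖x₀‖ D D T
    refine ⟨R₂, fun u c hc h0 hu => ?_⟩
    have hle : ∀ t (r : ℝ), 0 ≤ r → c t * r ≤ r := fun t r hr =>
      mul_le_of_le_one_left hr (hc t).2
    have hinc : ∀ t, ‖incl (c t • u t)‖ ≤ ‖incl (u t)‖ := fun t => by
      rw [ContinuousLinearMap.map_smul_of_tower, norm_smul, Real.norm_of_nonneg (hc t).1]
      exact hle t _ (norm_nonneg _)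
    have h1 : ∀ t ∈ Icc (-T) T, ‖incl (u t)‖ ≤ R₁ := by
      refine hgr₁ Hardy (fun t => incl (u t)) (fun t => incl (eX y a (c t • u t))) (fun t ht => ?_)
        ?_ fun t ht => ?_
      · exact (incl.restrictScalars ℝ).hasFDerivAt.comp_hasDerivWithinAt t (hu t ht)
      · rw [h0]; exact norm_incl_le _
      · exact (hC _).trans (by have := hinc t; gcongr)
    refine hgr₂ Wiener u _ hu (by rw [h0]) fun t ht => ?_
    refine (hD _ ((hinc t).trans (h1 t ht))).trans ?_
    have : ‖c t • u t‖ ≤ ‖u t‖ := by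
      rw [norm_smul, Real.norm_of_nonneg (hc t).1]
      exact hle t _ (norm_nonneg _)
    gcongr

theorem exists_solution (hy : ∀ k, 0 < y k) (a : Fin m → ℝ) (x₀ : Wiener) :
    ∃ U : ℝ → Wiener, U 0 = x₀ ∧
    ∀ t, HasDerivAt U (eX y a (U t)) t := by
  choose U hU0 hU using fun n : ℕ => exists_solution_Icc hy a (T := n + 1) (by positivity) x₀
  have hin : ∀ (n : ℕ), ∀ t ∈ Ioo (-(n + 1) : ℝ) (n + 1), HasDerivAt (U n) (eX y a (U n t)) t :=
    fun n t ht => (hU n t (Ioo_subset_Icc_self ht)).hasDerivAt (Icc_mem_nhds ht.1 ht.2)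
  have huniq : ∀ n m : ℕ, n ≤ m → EqOn (U n) (U m) (Ioo (-(n + 1) : ℝ) (n + 1)) := by
    intro n m hnm
    have hnm' : (n : ℝ) ≤ m := by exact_mod_cast hnm
    obtain ⟨R₁, hR₁⟩ := (isCompact_Icc (a := (-(n + 1) : ℝ)) (b := n + 1)).exists_bound_of_continuousOn
      (f := U n) fun t ht => (hU n t ht).continuousWithinAt
    obtain ⟨R₂, hR₂⟩ := (isCompact_Icc (a := (-(m + 1) : ℝ)) (b := m + 1)).exists_bound_of_continuousOn
      (f := U m) fun t ht => (hU m t ht).continuousWithinAt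
    obtain ⟨K, hK0, -, hK⟩ := (isNice_eX hy a).2 (max R₁ R₂)
    refine ODE_solution_unique_of_mem_Ioo (v := fun _ => eX y a)
      (s := fun _ => closedBall 0 (max R₁ R₂)) (K := ⟨K, hK0⟩) (t₀ := 0)
      (fun t ht => LipschitzOnWith.of_dist_le_mul fun x hx x' hx' => ?_) ?_ ?_ ?_ ?_
    · rw [mem_closedBall_zero_iff] at hx hx'
      rw [dist_eq_norm, dist_eq_norm]
      exact hK x x' hx hx'
    · constructor <;> linarith [n.cast_nonneg (α := ℝ)]
    · exact fun t ht => ⟨hin n t ht, mem_closedBall_zero_iff.2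
        ((hR₁ t (Ioo_subset_Icc_self ht)).trans (le_max_left _ _))⟩
    · intro t ht
      have ht' : t ∈ Ioo (-(m + 1) : ℝ) (m + 1) := ⟨by linarith [ht.1], by linarith [ht.2]⟩
      exact ⟨hin m t ht', mem_closedBall_zero_iff.2
        ((hR₂ t (Ioo_subset_Icc_self ht')).trans (le_max_right _ _))⟩
    · rw [hU0, hU0]
  have hmem : ∀ (t : ℝ) (n : ℕ), |t| ≤ n → t ∈ Ioo (-(n + 1) : ℝ) (n + 1) := fun t n h => by
    rw [abs_le] at h
    constructor <;> linarith [h.1, h.2]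
  refine ⟨fun t => U ⌈|t|⌉₊ t, hU0 _, fun t => ?_⟩
  set N := ⌈|t|⌉₊ + 1 with hN
  have htN : |t| < N := (Nat.le_ceil _).trans_lt (by rw [hN]; push_cast; linarith)
  have hev : (fun s => U ⌈|s|⌉₊ s) =ᶠ[nhds t] U N := by
    filter_upwards [(continuous_abs.tendsto t).eventually (gt_mem_nhds htN)] with s hs
    exact huniq _ _ (Nat.ceil_le.2 hs.le) (hmem _ _ (Nat.le_ceil _))
  have h := (hin N t (hmem _ _ htN.le)).congr_of_eventuallyEq hev
  rwa [← hev.self_of_nhds] at h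

end GlobalExistence

section Isospectral

open Set

/-- Along a solution of a Lax type equation `Γ' = AΓ + ΓB`, any value of `Γ` factors through any
other. -/
theorem exists_eq_mul_mul {𝔸 : Type} [NormedRing 𝔸] [NormedAlgebra ℝ 𝔸] [CompleteSpace 𝔸]
    {Γ A B : ℝ → 𝔸} (hΓ : ∀ t, HasDerivAt Γ (A t * Γ t + Γ t * B t) t) (hA : Continuous A)
    (hB : Continuous B) (s t : ℝ) : ∃ W V : 𝔸, Γ s = W * Γ t * V := by
  obtain ⟨W, hW0, hW⟩ := exists_linear_solution_Icc (T := |t - s|) (abs_nonneg _)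
    (B := fun r => -((ContinuousLinearMap.mul ℝ 𝔸).flip (A (s + r)))) (by fun_prop) (1 : 𝔸)
  obtain ⟨V, hV0, hV⟩ := exists_linear_solution_Icc (T := |t - s|) (abs_nonneg _)
    (B := fun r => -(ContinuousLinearMap.mul ℝ 𝔸 (B (s + r)))) (by fun_prop) (1 : 𝔸)
  have hG : ∀ r, HasDerivAt (fun r => Γ (s + r))
      (A (s + r) * Γ (s + r) + Γ (s + r) * B (s + r)) r := fun r =>
    HasDerivAt.comp_const_add s r (hΓ (s + r))
  have hd : ∀ r ∈ Icc (-|t - s|) |t - s|,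
      HasDerivWithinAt (fun r => W r * Γ (s + r) * V r) 0 (Icc (-|t - s|) |t - s|) r := by
    intro r hr
    refine (((hW r hr).mul (hG r).hasDerivWithinAt).mul (hV r hr)).congr_deriv ?_
    change (-(W r * A (s + r)) * Γ (s + r)
      + W r * (A (s + r) * Γ (s + r) + Γ (s + r) * B (s + r))) * V r
      + W r * Γ (s + r) * -(B (s + r) * V r) = 0
    noncomm_ring
  have hdiff : DifferentiableOn ℝ (fun r => W r * Γ (s + r) * V r) (Icc (-|t - s|) |t - s|) :=
    fun r hr => (hd r hr).differentiableWithinAt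
  have hconst : W 0 * Γ (s + 0) * V 0 = W (t - s) * Γ (s + (t - s)) * V (t - s) := by
    have h0 : (0 : ℝ) ∈ Icc (-|t - s|) |t - s| := ⟨by simp, by simp⟩
    have h1 : t - s ∈ Icc (-|t - s|) |t - s| := ⟨neg_abs_le _, le_abs_self _⟩
    have := (convex_Icc (-|t - s|) |t - s|).norm_image_sub_le_of_norm_hasDerivWithin_le
      (C := 0) hd (by simp) h1 h0
    simpa [sub_eq_zero] using this
  refine ⟨W (t - s), V (t - s), ?_⟩
  simpa [hW0, hV0] using hconst

end Isospectral

section Lax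

variable {y : ℝ} {u w Z : Wiener}

/-- The left factor of the Lax equation for `w^y H_u(w^y)`. -/
def laxLeft (w : Wiener) : Hardy →L[ℂ] Hardy := hM w * hN (star w)

/-- The right factor of the Lax equation of the shifted Hankel operator. -/
def laxRightShift (y : ℝ) (Z : Wiener) : Hardy →L[ℂ] Hardy :=
  (-y : ℂ) • (hM (star Z) * hN Z)

/-- The right factor of the Lax equation of the Hankel operator. -/
def laxRight (y : ℝ) (Z : Wiener) : Hardy →L[ℂ] Hardy :=
  laxRightShift y Z + (y : ℂ) • ContinuousLinearMap.smulRightL ℂ Hardy Hardy (hcoord 0 ∘L hN Z)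
    (incl (star Z))

theorem continuous_laxLeft : Continuous laxLeft := by
  unfold laxLeft
  fun_prop

theorem continuous_laxRightShift : Continuous (laxRightShift y) := by
  unfold laxRightShift
  fun_prop

theorem continuous_laxRight : Continuous (laxRight y) := by
  have := continuous_laxRightShift (y := y)
  unfold laxRight
  fun_prop

theorem laxRight_apply (h : Hardy) : laxRight y Z h
    = -(y : ℂ) • hM (star Z) (hN Z h) + (y : ℂ) • (hN Z h) 0 • incl (star Z) := rfl

theorem hΓ_Z (hp : IsResolventPair y u w Z) (h : Hardy) : hΓ Z h = hN (star w) (hΓ u h) := by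
  conv_lhs => rw [hp.1, hΓ_wcor, hΓ_comp_hM]
  rfl

theorem hΓ_w (hp : IsResolventPair y u w Z) (h : Hardy) :
    hΓ w h = h 0 • hδ 0 - (y : ℂ) • hΓ u (hM (star Z) h) := by
  conv_lhs => rw [hp.2, map_sub, map_smul, hΓ_wcor, _root_.sub_apply, hΓ_wδ_zero]
  rfl

theorem hΓ_apply_zero (u : Wiener) (h : Hardy) : hΓ u h 0 = hN u h 0 := by
  have : hcoord 0 ∘L hΓ u = hcoord 0 ∘L hN u := hardy_ext fun q => by
    have : (hcoord 0) ∘L hΓ.flip (hδ q) = (hcoord 0) ∘L hN.flip (hδ q) := wiener_ext fun k => by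
      simp only [ContinuousLinearMap.comp_apply, ContinuousLinearMap.flip_apply, hΓ_wδ_hδ,
        hN_wδ_hδ, hcoord_apply]
      rcases lt_trichotomy q k with h | h | h
      · rw [if_pos h.le, if_neg h.not_ge, hδ_apply, if_neg (by omega)]; rfl
      · rw [if_pos h.le, if_pos h.ge, h]
      · rw [if_neg h.not_ge, if_pos h.le, hδ_apply, if_neg (by omega)]; rfl
    exact DFunLike.congr_fun this u
  exact DFunLike.congr_fun this h

theorem hΓ_wmul_eq (hp : IsResolventPair y u w Z) :
    hΓ (wmul w Z) = laxLeft w * hΓ u + hΓ u * laxRight y Z := by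
  ext1 h
  rw [hΓ_wmul, hΓ_Z hp, hΓ_w hp, incl_w hp, _root_.add_apply, mul_apply_eq_comp,
    mul_apply_eq_comp, laxLeft, mul_apply_eq_comp, laxRight_apply, map_add, map_smul, map_smul,
    map_smul]
  module

theorem hSb_hΓ_wmul_eq (hp : IsResolventPair y u w Z) :
    hSb * hΓ (wmul w Z) = laxLeft w * (hSb * hΓ u) + (hSb * hΓ u) * laxRightShift y Z := by
  ext1 h
  have h1 : hSb (hM w (hΓ Z h))
      = hM w (hN (star w) (hSb (hΓ u h))) + (hN Z h) 0 • hSb (incl w) := by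
    rw [hSb_hM, hΓ_apply_zero, hΓ_Z hp, hN_hSb]
  have h2 : hSb (hδ 0) = 0 := by
    ext n
    rw [hSb_apply, hδ_apply, if_neg (by omega)]
    rfl
  have h3 : laxRightShift y Z h = -(y : ℂ) • hM (star Z) (hN Z h) := rfl
  rw [mul_apply_eq_comp, hΓ_wmul, map_sub, map_add, h1, map_smul, hΓ_w hp, map_sub, map_smul,
    map_smul, h2]
  simp only [_root_.add_apply, mul_apply_eq_comp, laxLeft, h3, map_smul]
  module

end Lax

section LaxFlow

variable {m : ℕ} {y : Fin m → ℝ} {a : Fin m → ℝ} {U : ℝ → Wiener}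
theorem wι_eX {m : ℕ} (y a : Fin m → ℝ) (x : Wiener) : wι (eX y a x)
    = ∑ k, (2 * Complex.I * (y k : ℂ) * (a k : ℂ)) • wmul (wι (eW (y k) x)) (wι (eZ (y k) x)) := by
  rw [eX, map_sum]
  exact Finset.sum_congr rfl fun k _ => by rw [map_smul, wι_emul]

theorem continuous_wι_eW (hy : ∀ k, 0 < y k)
    (hU : ∀ t, HasDerivAt U (eX y a (U t)) t) (k : Fin m) :
    Continuous fun t => wι (eW (y k) (U t)) :=
  wι.continuous.comp ((isNice_eW (hy k)).1.continuous.comp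
    (continuous_iff_continuousAt.2 fun t => (hU t).continuousAt))

theorem continuous_wι_eZ (hy : ∀ k, 0 < y k)
    (hU : ∀ t, HasDerivAt U (eX y a (U t)) t) (k : Fin m) :
    Continuous fun t => wι (eZ (y k) (U t)) :=
  wι.continuous.comp ((isNice_eZ (hy k)).1.continuous.comp
    (continuous_iff_continuousAt.2 fun t => (hU t).continuousAt))

theorem hΓ_flow_factor (hy : ∀ k, 0 < y k)
    (hU : ∀ t, HasDerivAt U (eX y a (U t)) t) (s t : ℝ) :
    ∃ W V : Hardy →L[ℂ] Hardy,
    hΓ (wι (U s)) = W * hΓ (wι (U t)) * V := by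
  refine exists_eq_mul_mul (Γ := fun t => hΓ (wι (U t)))
    (A := fun t => ∑ k, (2 * Complex.I * (y k : ℂ) * (a k : ℂ)) • laxLeft (wι (eW (y k) (U t))))
    (B := fun t => ∑ k, (2 * Complex.I * (y k : ℂ) * (a k : ℂ))
      • laxRight (y k) (wι (eZ (y k) (U t)))) (fun t => ?_) ?_ ?_ s t
  · have h := ((hΓ ∘L wι).restrictScalars ℝ).hasFDerivAt.comp_hasDerivAt t (hU t)
    refine h.congr_deriv ?_
    change hΓ (wι (eX y a (U t))) = _
    rw [wι_eX, map_sum, Finset.sum_mul, Finset.mul_sum, ← Finset.sum_add_distrib]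
    refine Finset.sum_congr rfl fun k _ => ?_
    rw [map_smul, hΓ_wmul_eq (isResolventPair_eW_eZ (hy k) (U t)), smul_add, smul_mul_assoc,
      mul_smul_comm]
  · exact continuous_finsetSum _ fun k _ =>
      (continuous_laxLeft.comp (continuous_wι_eW hy hU k)).const_smul (2 * Complex.I * (y k : ℂ) * (a k : ℂ))
  · exact continuous_finsetSum _ fun k _ =>
      (continuous_laxRight.comp (continuous_wι_eZ hy hU k)).const_smul (2 * Complex.I * (y k : ℂ) * (a k : ℂ))

theorem hSb_hΓ_flow_factor (hy : ∀ k, 0 < y k)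
    (hU : ∀ t, HasDerivAt U (eX y a (U t)) t) (s t : ℝ) :
    ∃ W V : Hardy →L[ℂ] Hardy,
    hSb * hΓ (wι (U s)) = W * (hSb * hΓ (wι (U t))) * V := by
  refine exists_eq_mul_mul (Γ := fun t => hSb * hΓ (wι (U t)))
    (A := fun t => ∑ k, (2 * Complex.I * (y k : ℂ) * (a k : ℂ)) • laxLeft (wι (eW (y k) (U t))))
    (B := fun t => ∑ k, (2 * Complex.I * (y k : ℂ) * (a k : ℂ))
      • laxRightShift (y k) (wι (eZ (y k) (U t)))) (fun t => ?_) ?_ ?_ s t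
  · have h := ((hΓ ∘L wι).restrictScalars ℝ).hasFDerivAt.comp_hasDerivAt t (hU t)
    refine (h.const_mul hSb).congr_deriv ?_
    change hSb * hΓ (wι (eX y a (U t))) = _
    rw [wι_eX, map_sum, Finset.sum_mul, Finset.mul_sum, Finset.mul_sum,
      ← Finset.sum_add_distrib]
    refine Finset.sum_congr rfl fun k _ => ?_
    rw [map_smul, mul_smul_comm, hSb_hΓ_wmul_eq (isResolventPair_eW_eZ (hy k) (U t)), smul_add,
      smul_mul_assoc, mul_smul_comm]
  · exact continuous_finsetSum _ fun k _ =>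
      (continuous_laxLeft.comp (continuous_wι_eW hy hU k)).const_smul (2 * Complex.I * (y k : ℂ) * (a k : ℂ))
  · exact continuous_finsetSum _ fun k _ =>
      (continuous_laxRightShift.comp (continuous_wι_eZ hy hU k)).const_smul (2 * Complex.I * (y k : ℂ) * (a k : ℂ))

end LaxFlow

section Rank

/-- The coefficient map as a linear map. -/
def coeffsLM : Hardy →ₗ[ℂ] (ℕ → ℂ) where
  toFun := coeffs
  map_add' _ _ := rfl
  map_smul' _ _ := rfl

theorem coeffsLM_injective : Function.Injective coeffsLM := fun _ _ h => lp.ext h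

theorem hankelLM_single (u : ℕ → ℂ) (p : ℕ) :
    hankelLM u (Finsupp.single p 1) = fun n => u (n + p) := by
  simp [hankelLM]

variable {T : Hardy →L[ℂ] Hardy} {u : ℕ → ℂ}

/-- The span of the columns of an operator of `L²₊`. -/
def colSpan (T : Hardy →L[ℂ] Hardy) : Submodule ℂ Hardy :=
  Submodule.span ℂ (Set.range fun p => T (hδ p))

theorem range_hankelLM (hT : ∀ p n, T (hδ p) n = u (n + p)) :
    LinearMap.range (hankelLM u) = (colSpan T).map coeffsLM := by
  have h1 : hankelLM u = coeffsLM ∘ₗ Finsupp.linearCombination ℂ (fun p => T (hδ p)) := by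
    refine Finsupp.lhom_ext' fun p => LinearMap.ext_ring ?_
    ext n
    simp only [LinearMap.comp_apply, Finsupp.lsingle_apply, hankelLM_single,
      Finsupp.linearCombination_single, one_smul]
    exact (hT p n).symm
  rw [h1, LinearMap.range_comp, Finsupp.range_linearCombination, colSpan]

theorem colSpan_le_range (T : Hardy →L[ℂ] Hardy) : colSpan T ≤ LinearMap.range T.toLinearMap := by
  rw [colSpan, Submodule.span_le]
  rintro _ ⟨p, rfl⟩
  exact ⟨hδ p, rfl⟩

theorem colSpan_eq_range [FiniteDimensional ℂ (colSpan T)] :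
    colSpan T = LinearMap.range T.toLinearMap := by
  refine (colSpan_le_range T).antisymm ?_
  rintro _ ⟨h, rfl⟩
  have hc : IsClosed (colSpan T : Set Hardy) := (colSpan T).closed_of_finiteDimensional
  refine hc.mem_of_tendsto (T.hasSum (hasSum_smul_hδ h)) (Filter.Eventually.of_forall fun s => ?_)
  refine Submodule.sum_mem _ fun k _ => ?_
  rw [map_smul]
  exact Submodule.smul_mem _ _ (Submodule.subset_span ⟨k, rfl⟩)

/-- The Hankel matrix of `u` has rank `r`, in terms of the operator it defines. -/
theorem hankelLM_finrank_iff (hT : ∀ p n, T (hδ p) n = u (n + p)) (r : ℕ) :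
    FiniteDimensional ℂ (LinearMap.range (hankelLM u)) ∧ hankelRank u = r ↔
      FiniteDimensional ℂ (LinearMap.range T.toLinearMap) ∧
        Module.finrank ℂ (LinearMap.range T.toLinearMap) = r := by
  have e : colSpan T ≃ₗ[ℂ] LinearMap.range (hankelLM u) :=
    (Submodule.equivMapOfInjective coeffsLM coeffsLM_injective _).trans
      (LinearEquiv.ofEq _ _ (range_hankelLM hT).symm)
  rw [hankelRank, ← e.finrank_eq]
  constructor
  · rintro ⟨h1, h2⟩
    have : FiniteDimensional ℂ (colSpan T) := e.symm.finiteDimensional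
    rw [← colSpan_eq_range]
    exact ⟨this, h2⟩
  · rintro ⟨h1, h2⟩
    have : FiniteDimensional ℂ (colSpan T) := Submodule.finiteDimensional_of_le (colSpan_le_range T)
    rw [← colSpan_eq_range] at h2
    exact ⟨e.finiteDimensional, h2⟩

theorem finrank_range_mul_le (W T V : Hardy →L[ℂ] Hardy)
    [FiniteDimensional ℂ (LinearMap.range T.toLinearMap)] :
    FiniteDimensional ℂ (LinearMap.range (W * T * V).toLinearMap) ∧
      Module.finrank ℂ (LinearMap.range (W * T * V).toLinearMap)
        ≤ Module.finrank ℂ (LinearMap.range T.toLinearMap) := by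
  have h : LinearMap.range (W * T * V).toLinearMap
      ≤ (LinearMap.range T.toLinearMap).map W.toLinearMap := by
    rintro _ ⟨x, rfl⟩
    exact ⟨T (V x), ⟨V x, rfl⟩, rfl⟩
  exact ⟨Submodule.finiteDimensional_of_le h,
    (Submodule.finrank_mono h).trans (Submodule.finrank_map_le _ _)⟩

theorem finrank_range_eq_of_factor {T T' W V W' V' : Hardy →L[ℂ] Hardy} (h : T' = W * T * V)
    (h' : T = W' * T' * V') [FiniteDimensional ℂ (LinearMap.range T.toLinearMap)] :
    FiniteDimensional ℂ (LinearMap.range T'.toLinearMap) ∧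
      Module.finrank ℂ (LinearMap.range T'.toLinearMap)
        = Module.finrank ℂ (LinearMap.range T.toLinearMap) := by
  have h1 := finrank_range_mul_le W T V
  rw [← h] at h1
  have := h1.1
  have h2 := finrank_range_mul_le W' T' V'
  rw [← h'] at h2
  exact ⟨h1.1, h1.2.antisymm h2.2⟩

theorem inHs_half_incl_wι (x : Wiener) : InHs (1 / 2) (coeffs (incl (wι x))) := by
  have hb : ∀ k : ℕ, ((1 : ℝ) + (k : ℝ) ^ 2) ^ (1 / 2 : ℝ) * ‖coeffs (incl (wι x)) k‖ ^ 2
      ≤ ‖x‖ * ‖x k‖ := fun k => by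
    have h1 : ((1 : ℝ) + (k : ℝ) ^ 2) ^ (1 / 2 : ℝ) ≤ k + 1 := by
      rw [← Real.sqrt_eq_rpow, Real.sqrt_le_left (by positivity)]
      nlinarith [k.cast_nonneg (α := ℝ)]
    have h2 : ‖coeffs (incl (wι x)) k‖ = (k + 1 : ℝ)⁻¹ * ‖x k‖ := by
      rw [coeffs, incl_apply, wι_apply, norm_mul, norm_inv, natCast_add_one_norm]
    have h3 : ‖x k‖ ≤ ‖x‖ := lp.norm_apply_le_norm one_ne_zero _ _
    have h4 : (k + 1 : ℝ)⁻¹ ≤ 1 := inv_le_one_of_one_le₀ (by linarith [k.cast_nonneg (α := ℝ)])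
    calc _ ≤ (k + 1 : ℝ) * ((k + 1 : ℝ)⁻¹ * ‖x k‖) ^ 2 := by rw [h2]; gcongr
      _ = (k + 1 : ℝ)⁻¹ * ‖x k‖ * ‖x k‖ := by field_simp
      _ ≤ 1 * ‖x‖ * ‖x k‖ := by gcongr
      _ = _ := by rw [one_mul]
  exact Summable.of_nonneg_of_le (fun _ => by positivity) hb
    ((wiener_hasSum_norm x).summable.mul_left _)

theorem hΓ_hδ_coeffs (x : Wiener) (p n : ℕ) :
    hΓ (wι x) (hδ p) n = coeffs (incl (wι x)) (n + p) := by
  rw [hΓ_hδ_apply, coeffs, incl_apply]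

theorem hSb_hΓ_hδ_coeffs (x : Wiener) (p n : ℕ) :
    (hSb * hΓ (wι x)) (hδ p) n = coeffs (incl (wι x)) (n + p + 1) := by
  rw [mul_apply_eq_comp, hSb_apply, hΓ_hδ_coeffs, add_right_comm]

/-- The rank conditions defining `𝒱(d)`, in terms of the operators `Γ_u` and `S*Γ_u`. -/
theorem inV_incl_wι_iff (d : ℕ) (x : Wiener) : InV d (coeffs (incl (wι x))) ↔
    (FiniteDimensional ℂ (LinearMap.range (hΓ (wι x)).toLinearMap) ∧
      Module.finrank ℂ (LinearMap.range (hΓ (wι x)).toLinearMap) = (d + 1) / 2) ∧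
    (FiniteDimensional ℂ (LinearMap.range (hSb * hΓ (wι x)).toLinearMap) ∧
      Module.finrank ℂ (LinearMap.range (hSb * hΓ (wι x)).toLinearMap) = d / 2) := by
  have h1 := hankelLM_finrank_iff (hΓ_hδ_coeffs x) ((d + 1) / 2)
  have h2 := hankelLM_finrank_iff (u := fun n => coeffs (incl (wι x)) (n + 1))
    (hSb_hΓ_hδ_coeffs x) (d / 2)
  rw [← h1, ← h2, InV]
  constructor
  · rintro ⟨-, h3, h4, h5⟩
    refine ⟨⟨h3, h4⟩, ?_, h5⟩
    have := (h1.1 ⟨h3, h4⟩).1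
    have h6 := (finrank_range_mul_le hSb (hΓ (wι x)) 1).1
    rw [mul_one] at h6
    exact ((hankelLM_finrank_iff (u := fun n => coeffs (incl (wι x)) (n + 1))
      (hSb_hΓ_hδ_coeffs x) _).2 ⟨h6, rfl⟩).1
  · rintro ⟨⟨h3, h4⟩, -, h5⟩
    exact ⟨inHs_half_incl_wι x, h3, h4, h5⟩

theorem inV_flow {m : ℕ} {y : Fin m → ℝ} (hy : ∀ k, 0 < y k) {a : Fin m → ℝ} {U : ℝ → Wiener}
    (hU : ∀ t, HasDerivAt U (eX y a (U t)) t) {d : ℕ} {s : ℝ}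
    (h : InV d (coeffs (incl (wι (U s))))) (t : ℝ) : InV d (coeffs (incl (wι (U t)))) := by
  rw [inV_incl_wι_iff] at h ⊢
  obtain ⟨⟨h1, h2⟩, h3, h4⟩ := h
  rw [← h2, ← h4]
  obtain ⟨_, _, e1⟩ := hΓ_flow_factor hy hU s t
  obtain ⟨_, _, e2⟩ := hΓ_flow_factor hy hU t s
  obtain ⟨_, _, e3⟩ := hSb_hΓ_flow_factor hy hU s t
  obtain ⟨_, _, e4⟩ := hSb_hΓ_flow_factor hy hU t s
  exact ⟨finrank_range_eq_of_factor e2 e1, finrank_range_eq_of_factor e4 e3⟩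

end Rank

section Decay

theorem tendsto_hSb_pow (h : Hardy) :
    Filter.Tendsto (fun n => (hSb ^ n) h) Filter.atTop (nhds 0) := by
  rw [tendsto_zero_iff_norm_tendsto_zero]
  have h1 : ∀ n, ‖(hSb ^ n) h‖ ^ 2 = ∑' k, ‖h (k + n)‖ ^ 2 := fun n => by
    rw [← (hardy_hasSum_sq _).tsum_eq]
    simp_rw [hSb_pow_apply]
  have h2 := tendsto_sum_nat_add fun k => ‖h k‖ ^ 2
  have h3 := (Real.continuous_sqrt.tendsto 0).comp h2
  rw [Real.sqrt_zero] at h3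
  refine h3.congr fun n => ?_
  rw [Function.comp_apply, ← h1, Real.sqrt_sq (norm_nonneg _)]

/-- In finite dimension, strongly stable operators are exponentially stable. -/
theorem exists_norm_pow_le {F : Type*} [NormedAddCommGroup F] [NormedSpace ℂ F]
    [FiniteDimensional ℂ F] (L : F →L[ℂ] F)
    (hL : ∀ x, Filter.Tendsto (fun n => (L ^ n) x) Filter.atTop (nhds 0)) :
    ∃ N, 0 < N ∧ ‖L ^ N‖ ≤ 1 / 2 := by
  let b := Module.finBasis ℂ F
  obtain ⟨C, hC, hb⟩ := b.exists_opNorm_le (F := F)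
  have h1 : ∀ᶠ n in Filter.atTop, ∀ i, ‖(L ^ n) (b i)‖ ≤ (2 * C)⁻¹ := by
    refine Filter.eventually_all.2 fun i => ?_
    have h2 := (tendsto_zero_iff_norm_tendsto_zero.1 (hL (b i))).eventually
      (gt_mem_nhds (show (0 : ℝ) < (2 * C)⁻¹ by positivity))
    exact h2.mono fun n hn => hn.le
  obtain ⟨N, hN, hN0⟩ := (h1.and (Filter.eventually_gt_atTop 0)).exists
  refine ⟨N, hN0, (hb (by positivity) hN).trans_eq ?_⟩
  field_simp

/-- Symbols of finite rank Hankel operators have absolutely summable weighted coefficients. -/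
theorem exists_incl_wι_eq {u : Hardy}
    (hu : FiniteDimensional ℂ (LinearMap.range (hankelLM (coeffs u)))) :
    ∃ x : Wiener, incl (wι x) = u := by
  let F : Submodule ℂ Hardy := Submodule.span ℂ (Set.range fun p => (hSb ^ p) u)
  have hF : F.map coeffsLM ≤ LinearMap.range (hankelLM (coeffs u)) := by
    rw [Submodule.map_span, Submodule.span_le]
    rintro _ ⟨_, ⟨p, rfl⟩, rfl⟩
    refine ⟨Finsupp.single p 1, ?_⟩
    rw [hankelLM_single]
    exact funext fun n => (hSb_pow_apply p u n).symm
  have hFfd : FiniteDimensional ℂ F := by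
    have := Submodule.finiteDimensional_of_le hF
    exact (Submodule.equivMapOfInjective coeffsLM coeffsLM_injective F).symm.finiteDimensional
  have hinv : ∀ h ∈ F, hSb h ∈ F := by
    intro h hh
    have : F.map hSb.toLinearMap ≤ F := by
      rw [Submodule.map_span, Submodule.span_le]
      rintro _ ⟨_, ⟨p, rfl⟩, rfl⟩
      exact Submodule.subset_span ⟨p + 1, by
        change (hSb ^ (p + 1)) u = hSb ((hSb ^ p) u)
        rw [pow_succ']; rfl⟩
    exact this ⟨h, hh, rfl⟩
  let L : F →L[ℂ] F := (hSb ∘L F.subtypeL).codRestrict F fun x => hinv x x.2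
  have hLn : ∀ n (x : F), ((L ^ n) x : Hardy) = (hSb ^ n) x := by
    intro n x
    induction n with
    | zero => rfl
    | succ n ih => rw [pow_succ', pow_succ', mul_apply_eq_comp, mul_apply_eq_comp, ← ih]; rfl
  obtain ⟨N, hN0, hN⟩ := exists_norm_pow_le L fun x => by
    rw [tendsto_subtype_rng]
    simp_rw [hLn]
    exact tendsto_hSb_pow (x : Hardy)
  let u' : F := ⟨u, Submodule.subset_span ⟨0, rfl⟩⟩
  have hq : ∀ q, ‖(hSb ^ (N * q)) u‖ ≤ (1 / 2) ^ q * ‖u‖ := fun q => by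
    have h1 : ‖((L ^ N) ^ q) u'‖ ≤ (1 / 2) ^ q * ‖u'‖ := by
      induction q with
      | zero => simp
      | succ q ih =>
        rw [pow_succ', mul_apply_eq_comp]
        refine ((L ^ N).le_opNorm _).trans ((mul_le_mul hN ih (norm_nonneg _) (by norm_num)).trans ?_)
        rw [pow_succ', mul_assoc]
    rwa [← pow_mul, Submodule.coe_norm, hLn] at h1
  set ρ : ℝ := (1 / 2) ^ (1 / N : ℝ) with hρ
  have hρ0 : 0 < ρ := by positivity
  have hρ1 : ρ < 1 := Real.rpow_lt_one (by norm_num) (by norm_num) (by positivity)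
  have hρN : ρ ^ N = 1 / 2 := by
    rw [hρ, one_div (N : ℝ)]
    exact Real.rpow_inv_natCast_pow (by norm_num) hN0.ne'
  have hdec : ∀ n, ‖u n‖ ≤ 2 * ‖u‖ * ρ ^ n := fun n => by
    have h1 : ‖u n‖ ≤ ‖(hSb ^ n) u‖ := by
      have := lp.norm_apply_le_norm two_ne_zero ((hSb ^ n) u) 0
      rwa [hSb_pow_apply, zero_add] at this
    have h2 : ‖(hSb ^ n) u‖ ≤ ‖(hSb ^ (N * (n / N))) u‖ := by
      conv_lhs => rw [← Nat.mod_add_div n N, pow_add, mul_apply_eq_comp]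
      exact norm_hSb_pow_apply_le _ _
    have h3 : (1 / 2 : ℝ) ^ (n / N) ≤ 2 * ρ ^ n := by
      have h4 : ρ ^ N ≤ ρ ^ (n % N) := pow_le_pow_of_le_one hρ0.le hρ1.le (Nat.mod_lt _ hN0).le
      conv_rhs => rw [← Nat.mod_add_div n N, pow_add, pow_mul, hρN]
      rw [hρN] at h4
      have : (0 : ℝ) < (1 / 2) ^ (n / N) := by positivity
      nlinarith
    calc ‖u n‖ ≤ (1 / 2) ^ (n / N) * ‖u‖ := h1.trans (h2.trans (hq _))
      _ ≤ 2 * ρ ^ n * ‖u‖ := by gcongr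
      _ = _ := by ring
  have hsum : Summable fun n : ℕ => ‖((n + 1 : ℂ) * u n)‖ := by
    have h1 := summable_pow_mul_geometric_of_norm_lt_one 1
      (show ‖ρ‖ < 1 by rwa [Real.norm_of_nonneg hρ0.le])
    have h2 := (h1.add (summable_geometric_of_lt_one hρ0.le hρ1)).mul_left (2 * ‖u‖)
    refine Summable.of_nonneg_of_le (fun _ => norm_nonneg _) (fun n => ?_) h2
    rw [norm_mul, natCast_add_one_norm, pow_one]
    calc _ ≤ (n + 1 : ℝ) * (2 * ‖u‖ * ρ ^ n) := by gcongr; exact hdec n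
      _ = _ := by ring
  refine ⟨⟨fun n => (n + 1 : ℂ) * u n, memℓp_gen (by simpa using hsum)⟩, ?_⟩
  ext n
  rw [incl_apply, wι_apply]
  exact inv_mul_cancel_left₀ (natCast_add_one_ne n) _

end Decay

section Comparison

theorem inner_star_star (h g : Hardy) : inner ℂ (star h) (star g) = inner ℂ g h := by
  rw [lp.inner_eq_tsum, lp.inner_eq_tsum]
  refine tsum_congr fun n => ?_
  simp [lp.star_apply, mul_comm]

theorem inner_hΓ_star (u : Wiener) (h g : Hardy) :
    inner ℂ h (hΓ u (star g)) = inner ℂ g (hΓ u (star h)) := by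
  rw [← ContinuousLinearMap.adjoint_inner_left, adjoint_hΓ, ← inner_star_star, star_star, star_hΓ,
    star_star]

variable {y : ℝ} {u v w Z w' Z' : Wiener}

theorem sub_bounds_of_energy {A E d r : ℝ} (hd : 0 ≤ d) (hr : 0 < r)
    (h : A ^ 2 + r ^ 2 * E ^ 2 ≤ r ^ 2 * (A * (r⁻¹ * d)) + r ^ 2 * (E * d)) :
    A ≤ 2 * r * d ∧ E ≤ 2 * d := by
  have h1 : r ^ 2 * (A * (r⁻¹ * d)) = A * (r * d) := by field_simp
  rw [h1] at h
  have h2 : A ^ 2 + (r * E) ^ 2 ≤ 2 * (r * d) ^ 2 := by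
    nlinarith [sq_nonneg (A - r * d), sq_nonneg (r * E - r * d)]
  have h3 : 0 ≤ r * d := by positivity
  constructor
  · refine abs_le_of_sq_le_sq' ?_ (by positivity) |>.2
    nlinarith [sq_nonneg (r * E)]
  · have h4 : r * E ≤ r * (2 * d) := by
      refine abs_le_of_sq_le_sq' ?_ (by positivity) |>.2
      nlinarith [sq_nonneg A]
    exact le_of_mul_le_mul_left h4 hr

theorem norm_sub_le_of_isResolventPair (hy : 0 < y) (hp : IsResolventPair y u w Z)
    (hp' : IsResolventPair y v w' Z') :
    ‖incl w - incl w'‖ ≤ 2 * √y * ‖incl u - incl v‖ ∧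
      ‖incl Z - incl Z'‖ ≤ 2 * ‖incl u - incl v‖ := by
  set δ := incl w - incl w' with hδ
  set ε := incl Z - incl Z' with hε
  set q := hN (star Z) (incl (u - v)) with hq
  set p := hN (star w) (incl (u - v)) with hpd
  have hq' : q = hΓ u (star (incl Z)) - hΓ v (star (incl Z)) := by
    rw [hq, ← hΓ_incl, incl_star, map_sub]; rfl
  have hp'' : p = hΓ u (star (incl w)) - hΓ v (star (incl w)) := by
    rw [hpd, ← hΓ_incl, incl_star, map_sub]; rfl
  have e1 : δ = -(y : ℂ) • q - (y : ℂ) • hΓ v (star ε) := by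
    rw [hδ, hε, star_sub, map_sub, hq', incl_w hp, incl_w hp', incl_star, incl_star]
    module
  have e2 : ε = p + hΓ v (star δ) := by
    rw [hε, hp'', hδ, star_sub, map_sub, incl_Z hp, incl_Z hp', incl_star, incl_star]
    abel
  have h1 := congrArg (fun z => inner ℂ δ z) e1
  have h2 := congrArg (fun z => (y : ℂ) * inner ℂ ε z) e2
  simp only [inner_sub_right, inner_add_right, inner_smul_right] at h1 h2
  rw [inner_hΓ_star] at h1
  have h3 : ((‖δ‖ ^ 2 + y * ‖ε‖ ^ 2 : ℝ) : ℂ) = -(y : ℂ) * inner ℂ δ q + y * inner ℂ ε p := by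
    have i1 := inner_self_eq_norm_sq_to_K (𝕜 := ℂ) δ
    have i2 := inner_self_eq_norm_sq_to_K (𝕜 := ℂ) ε
    rw [i1] at h1
    rw [i2] at h2
    push_cast
    simp only [Complex.coe_algebraMap] at h1 h2
    linear_combination h1 + h2
  have h4 : ‖δ‖ ^ 2 + y * ‖ε‖ ^ 2 ≤ y * (‖δ‖ * ‖q‖) + y * (‖ε‖ * ‖p‖) := by
    have h5 := congrArg norm h3
    rw [Complex.norm_real, Real.norm_of_nonneg (by positivity)] at h5
    rw [h5]
    refine (norm_add_le _ _).trans ?_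
    rw [norm_mul, norm_mul, norm_neg, Complex.norm_real, Real.norm_of_nonneg hy.le]
    gcongr <;> exact norm_inner_le_norm _ _
  have hqn : ‖q‖ ≤ (√y)⁻¹ * ‖incl u - incl v‖ := by
    rw [← map_sub]
    refine (ContinuousLinearMap.le_opNorm _ _).trans ?_
    rw [norm_hN_star]
    gcongr
    exact norm_hM_Z_le hp hy
  have hpn : ‖p‖ ≤ ‖incl u - incl v‖ := by
    rw [← map_sub]
    refine (ContinuousLinearMap.le_opNorm _ _).trans ?_
    rw [norm_hN_star]
    exact mul_le_of_le_one_left (norm_nonneg _) (norm_hM_w_le hp hy)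
  refine sub_bounds_of_energy (norm_nonneg _)
    (Real.sqrt_pos.2 hy) ?_
  rw [Real.sq_sqrt hy.le]
  refine h4.trans ?_
  gcongr

theorem norm_incl_wmul_sub_le (hy : 0 < y) (hp : IsResolventPair y u w Z)
    (hp' : IsResolventPair y v w' Z') :
    ‖incl (wmul w Z) - incl (wmul w' Z')‖ ≤ 4 * ‖incl u - incl v‖ := by
  obtain ⟨h1, h2⟩ := norm_sub_le_of_isResolventPair hy hp hp'
  have e : incl (wmul w Z) - incl (wmul w' Z')
      = hM Z (incl w - incl w') + hM w' (incl Z - incl Z') := by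
    rw [map_sub, map_sub, ← incl_wmul, ← incl_wmul, ← incl_wmul, ← incl_wmul, wmul_comm Z w,
      wmul_comm Z w']
    abel
  have h3 : ‖hM Z (incl w - incl w')‖ ≤ (√y)⁻¹ * (2 * √y * ‖incl u - incl v‖) :=
    (ContinuousLinearMap.le_opNorm _ _).trans
      (mul_le_mul (norm_hM_Z_le hp hy) h1 (norm_nonneg _) (by positivity))
  have h4 : ‖hM w' (incl Z - incl Z')‖ ≤ 1 * (2 * ‖incl u - incl v‖) :=
    (ContinuousLinearMap.le_opNorm _ _).trans
      (mul_le_mul (norm_hM_w_le hp' hy) h2 (norm_nonneg _) zero_le_one)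
  have h5 : (√y)⁻¹ * (2 * √y * ‖incl u - incl v‖) = 2 * ‖incl u - incl v‖ := by
    have : √y ≠ 0 := (Real.sqrt_pos.2 hy).ne'
    field_simp
  rw [e]
  refine (norm_add_le _ _).trans ?_
  linarith

theorem exists_lipschitz_eX {m : ℕ} {y : Fin m → ℝ} (hy : ∀ k, 0 < y k) (a : Fin m → ℝ) :
    ∃ K : ℝ, 0 ≤ K ∧ ∀ x x' : Wiener, ‖incl (wι (eX y a x)) - incl (wι (eX y a x'))‖
      ≤ K * ‖incl (wι x) - incl (wι x')‖ := by
  refine ⟨∑ k, ‖2 * Complex.I * (y k : ℂ) * (a k : ℂ)‖ * 4, by positivity, fun x x' => ?_⟩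
  rw [wι_eX, wι_eX, map_sum, map_sum, ← Finset.sum_sub_distrib, Finset.sum_mul]
  refine (norm_sum_le _ _).trans (Finset.sum_le_sum fun k _ => ?_)
  rw [map_smul, map_smul, ← smul_sub, norm_smul, mul_assoc ‖_‖]
  gcongr
  exact norm_incl_wmul_sub_le (hy k) (isResolventPair_eW_eZ (hy k) x)
    (isResolventPair_eW_eZ (hy k) x')

end Comparison

section Hierarchy

theorem hankel_coeffs (u : Wiener) (h : Hardy) :
    hankel (coeffs (incl u)) (coeffs h) = coeffs (hΓ u (star h)) := by
  funext n
  rw [coeffs, ← (hasSum_hΓ u (star h) n).tsum_eq]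
  refine tsum_congr fun p => ?_
  rw [coeffs, incl_apply]
  rfl

theorem isResolventOne_iff {y : ℝ} (hy : 0 < y) (x : Wiener) (W : ℕ → ℂ) :
    IsResolventOne y (coeffs (incl (wι x))) W ↔ W = coeffs (incl (wι (eW y x))) := by
  have key : ∀ h : Hardy, (∀ n, coeffs h n + (y : ℂ) * hankel (coeffs (incl (wι x)))
      (hankel (coeffs (incl (wι x))) (coeffs h)) n = if n = 0 then 1 else 0) ↔
      hQ y (wι x) h = hδ 0 := by
    intro h
    rw [hankel_coeffs, hankel_coeffs, star_hΓ, star_star, hQ_apply, lp.ext_iff, funext_iff]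
    refine forall_congr' fun n => ?_
    rw [hδ_apply]
    rfl
  constructor
  · rintro ⟨h1, h2⟩
    have h3 := eq_hw_of_hQ hy ((key ⟨W, h1⟩).1 h2)
    rw [incl_wι_eW hy, ← h3]
    rfl
  · rintro rfl
    exact ⟨lp.memℓp _, (key _).2 (by rw [incl_wι_eW hy, hQ_hw hy])⟩

theorem sum_XJ_eq {m : ℕ} {y : Fin m → ℝ} (hy : ∀ k, 0 < y k) (a : Fin m → ℝ) (x : Wiener)
    (n : ℕ) : ∑ k, (a k : ℂ) * XJ (y k) (coeffs (incl (wι x)))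
      (coeffs (incl (wι (eW (y k) x)))) n = incl (wι (eX y a x)) n := by
  rw [wι_eX, map_sum, ← hcoord_apply, map_sum]
  refine Finset.sum_congr rfl fun k _ => ?_
  rw [XJ, hankel_coeffs, ← incl_star, ← incl_Z (isResolventPair_eW_eZ (hy k) x), map_smul, map_smul,
    hcoord_apply, incl_apply, wmul_apply, mulCoeff, smul_eq_mul, ← mul_assoc, mul_comm (a k : ℂ)]
  simp only [coeffs, incl_apply]

/-- The hierarchy equation in the weighted coordinates. -/
theorem isHierSolution_iff {m : ℕ} {y : Fin m → ℝ} (hy : ∀ k, 0 < y k) (a : Fin m → ℝ)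
    (U : ℝ → Wiener) : IsHierSolution m y a (fun t => incl (wι (U t))) ↔
      ∀ t n, HasDerivAt (fun τ : ℝ => incl (wι (U τ)) n) (incl (wι (eX y a (U t))) n) t := by
  constructor
  · intro h t n
    rw [← sum_XJ_eq hy]
    exact h t n _ fun k => (isResolventOne_iff (hy k) _ _).2 rfl
  · intro h t n W hW
    have : W = fun k => coeffs (incl (wι (eW (y k) (U t)))) :=
      funext fun k => (isResolventOne_iff (hy k) _ _).1 (hW k)
    subst this
    rw [sum_XJ_eq hy]
    exact h t n

theorem hasDerivAt_hcoord {v : ℝ → Hardy} {v' : Hardy} {t : ℝ} (h : HasDerivAt v v' t) (n : ℕ) :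
    HasDerivAt (fun τ => v τ n) (v' n) t :=
  ((hcoord n).restrictScalars ℝ).hasFDerivAt.comp_hasDerivAt t h

theorem eq_of_isHierSolution {m : ℕ} {y : Fin m → ℝ} (hy : ∀ k, 0 < y k) (a : Fin m → ℝ)
    {U V : ℝ → Wiener} (hU : IsHierSolution m y a (fun t => incl (wι (U t))))
    (hV : IsHierSolution m y a (fun t => incl (wι (V t))))
    (hUd : Differentiable ℝ fun t => incl (wι (U t)))
    (hVd : Differentiable ℝ fun t => incl (wι (V t))) (h0 : U 0 = V 0) :
    (fun t => incl (wι (U t))) = fun t => incl (wι (V t)) := by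
  have hinj : Function.Injective fun x => incl (wι x) := incl_injective.comp wι_injective
  obtain ⟨K, hK0, hK⟩ := exists_lipschitz_eX hy a
  let Y : Hardy → Hardy := fun h => incl (wι (eX y a (Function.invFun (fun x => incl (wι x)) h)))
  have hY : ∀ x, Y (incl (wι x)) = incl (wι (eX y a x)) := fun x =>
    congrArg (fun x => incl (wι (eX y a x))) (Function.leftInverse_invFun hinj x)
  have hder : ∀ (U : ℝ → Wiener), IsHierSolution m y a (fun t => incl (wι (U t))) →
      Differentiable ℝ (fun t => incl (wι (U t))) → ∀ t,
      HasDerivAt (fun t => incl (wι (U t))) (Y (incl (wι (U t)))) t := by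
    intro U hU hUd t
    refine (hUd t).hasDerivAt.congr_deriv ?_
    rw [hY]
    ext n
    exact (hasDerivAt_hcoord (hUd t).hasDerivAt n).unique ((isHierSolution_iff hy a U).1 hU t n)
  refine ODE_solution_unique_univ (v := fun _ => Y) (s := fun _ => Set.range fun x => incl (wι x))
    (K := ⟨K, hK0⟩) (t₀ := 0) (fun t => LipschitzOnWith.of_dist_le_mul ?_)
    (fun t => ⟨hder U hU hUd t, _, rfl⟩) (fun t => ⟨hder V hV hVd t, _, rfl⟩) (by rw [h0])
  rintro _ ⟨x, rfl⟩ _ ⟨x', rfl⟩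
  rw [dist_eq_norm, dist_eq_norm, hY, hY]
  exact hK x x'

end Hierarchy

/-- **Corollary 5.6**: the evolution equation `u̇ = X_Ĵ(u)` defines a (global, smooth) flow on
`𝒱(d)`: for every `u₀ ∈ 𝒱(d)` there is a unique global smooth solution with values in `𝒱(d)`
starting at `u₀`. -/
theorem statement17 (m : ℕ) (y a : Fin m → ℝ) (hy : ∀ k, 0 < y k) (d : ℕ) (hd : 0 < d)
    (u₀ : Hardy) (h₀ : InV d (coeffs u₀)) :
    ∃! u : ℝ → Hardy, ContDiff ℝ (⊤ : ℕ∞) u ∧ u 0 = u₀ ∧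
      (∀ t : ℝ, InV d (coeffs (u t))) ∧ IsHierSolution m y a u := by
  obtain ⟨x₀, rfl⟩ := exists_incl_wι_eq h₀.2.1
  obtain ⟨U, hU0, hU⟩ := exists_solution hy a x₀
  have hUs : ContDiff ℝ (⊤ : ℕ∞) fun t => incl (wι (U t)) :=
    ((incl ∘L wι).restrictScalars ℝ).contDiff.comp (contDiff_of_hasDerivAt (isNice_eX hy a).1 hU)
  have hUh : IsHierSolution m y a fun t => incl (wι (U t)) :=
    (isHierSolution_iff hy a U).2 fun t n => hasDerivAt_hcoord
      (((incl ∘L wι).restrictScalars ℝ).hasFDerivAt.comp_hasDerivAt t (hU t)) n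
  refine ⟨fun t => incl (wι (U t)), ⟨hUs, congrArg (fun x => incl (wι x)) hU0, inV_flow hy hU (s := 0) (by rwa [hU0]), hUh⟩,
    ?_⟩
  rintro v ⟨hvs, hv0, hvV, hvh⟩
  choose V hV using fun t => exists_incl_wι_eq (hvV t).2.1
  obtain rfl : (fun t => incl (wι (V t))) = v := funext hV
  refine eq_of_isHierSolution hy a hvh hUh (hvs.differentiable (by simp))
    (hUs.differentiable (by simp)) ?_
  rw [hU0]
  exact wι_injective (incl_injective hv0)

end
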